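/- arXiv:2504.19544 — 5 statements merged into one kernel-verified Lean document; each statement's English description precedes it below -/
import Mathlib

section
/- Let S_f, S_g ⊆ Fin m be finsets and S_h ⊆ S_f. Put S_{h*} = (S_f \ S_h) ∩ S_g with increasing enumeration i_1 < … < i_l, and assume |J_{fg}(i_j)| > j − 1 for all 1 ≤ j ≤ l. Then 2^{∑_{j=1}^{l} |J_{fg}(i_j)|} · |LTA(m,2)_f^g·x^{S_f\S_h}| = 2^{|S_f\S_h| + |λ_{S_f}(S_f\S_h)|} · ∏_{j=1}^{l} (2^{|J_{fg}(i_j)|} − 2^{j−1}). -/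
open Pointwise

/-- Boolean functions in `m` variables. -/
abbrev BF (m : ℕ) := (Fin m → ZMod 2) → ZMod 2

/-- The monomial `x^S`. -/
def mono {m : ℕ} (S : Finset (Fin m)) : BF m := fun v => ∏ i ∈ S, v i

/-- Hamming weight of a Boolean function. -/
def wt {m : ℕ} (F : BF m) : ℕ := (Finset.univ.filter fun v => F v = 1).card

/-- The action of an affine pair `(B, ε)` on the monomial `x^T`. -/
def act {m : ℕ} (B : Fin m → Fin m → ZMod 2) (ε : Fin m → ZMod 2)
    (T : Finset (Fin m)) : BF m :=
  fun v => ∏ i ∈ T, (v i + (∑ j, B i j * v j) + ε i)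

/-- The orbit `LTA(m,2)·x^S` of the monomial `x^S` under the full lower
triangular affine group. -/
def orbitFull {m : ℕ} (S : Finset (Fin m)) : Set (BF m) :=
  { F | ∃ B : Fin m → Fin m → ZMod 2, ∃ ε : Fin m → ZMod 2,
      (∀ i j : Fin m, B i j ≠ 0 → j < i) ∧ F = act B ε S }

/-- The subgroup `LTA(m,2)_S`, as a set of pairs `(B, ε)`. -/
def LTAsub {m : ℕ} (S : Finset (Fin m)) :
    Set ((Fin m → Fin m → ZMod 2) × (Fin m → ZMod 2)) :=
  { p | (∀ i, i ∉ S → p.2 i = 0) ∧ ∀ i j, p.1 i j ≠ 0 → i ∈ S ∧ j < i ∧ j ∉ S }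

/-- The orbit `LTA(m,2)_S·x^T`. -/
def orbitSub {m : ℕ} (S T : Finset (Fin m)) : Set (BF m) :=
  { F | ∃ p ∈ LTAsub S, F = act p.1 p.2 T }

/-- `S ≼_sh T`. -/
def shLE {m : ℕ} (S T : Finset (Fin m)) : Prop :=
  ∃ h : S.card = T.card, ∀ ℓ : Fin S.card,
    S.orderEmbOfFin rfl ℓ ≤ T.orderEmbOfFin h.symm ℓ

/-- `S ≺_sh T`. -/
def shLT {m : ℕ} (S T : Finset (Fin m)) : Prop :=
  ∃ h : S.card = T.card, ∀ ℓ : Fin S.card,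
    S.orderEmbOfFin rfl ℓ < T.orderEmbOfFin h.symm ℓ

/-- `S ≼ T`. -/
def decOrd {m : ℕ} (S T : Finset (Fin m)) : Prop := ∃ T' ⊆ T, shLE S T'

/-- A decreasing family of finsets. -/
def Decreasing {m : ℕ} (I : Finset (Finset (Fin m))) : Prop :=
  ∀ S T : Finset (Fin m), decOrd S T → T ∈ I → S ∈ I

/-- The code `C(I)`: the span of the monomials indexed by `I`. -/
noncomputable def code {m : ℕ} (I : Finset (Finset (Fin m))) :
    Submodule (ZMod 2) (BF m) :=
  Submodule.span (ZMod 2) (mono '' ↑I)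

/-- `J_S(i) = {j < i : j ∉ S}`. -/
def Jset {m : ℕ} (S : Finset (Fin m)) (i : Fin m) : Finset (Fin m) :=
  Finset.univ.filter fun j => j < i ∧ j ∉ S

/-- `J_{fg}(i) = {j < i : j ∉ S_f ∪ S_g}`. -/
def Jfg {m : ℕ} (Sf Sg : Finset (Fin m)) (i : Fin m) : Finset (Fin m) :=
  Jset (Sf ∪ Sg) i

/-- `|λ_S(T)| = ∑_{i ∈ T} |J_S(i)|`. -/
def lamOf {m : ℕ} (S T : Finset (Fin m)) : ℕ := ∑ i ∈ T, (Jset S i).card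

/-- The column set `J_{fg}(i_l)`, where `i_l` is the largest element of
`S_{h*} = (S_f \ S_h) ∩ S_g` (empty if `S_{h*}` is empty). -/
def Jcols {m : ℕ} (Sf Sg Sh : Finset (Fin m)) : Finset (Fin m) :=
  Finset.univ.filter fun j => (∃ i ∈ (Sf \ Sh) ∩ Sg, j < i) ∧ j ∉ Sf ∪ Sg

/-- The restricted subgroup `LTA(m,2)_f^g`: members of `LTA(m,2)_{S_f}` whose
submatrix with rows `S_{h*} = (S_f \ S_h) ∩ S_g` and columns `J_{fg}(i_l)` has
full row rank. -/
def LTAres {m : ℕ} (Sf Sg Sh : Finset (Fin m)) :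
    Set ((Fin m → Fin m → ZMod 2) × (Fin m → ZMod 2)) :=
  { p ∈ LTAsub Sf |
      Matrix.rank
        (Matrix.of fun (i : ((Sf \ Sh) ∩ Sg : Finset (Fin m)))
          (j : (Jcols Sf Sg Sh : Finset (Fin m))) => p.1 i.1 j.1)
        = ((Sf \ Sh) ∩ Sg).card }

/-- The orbit `LTA(m,2)_f^g·x^{S_f \ S_h}`. -/
def orbitRes {m : ℕ} (Sf Sg Sh : Finset (Fin m)) : Set (BF m) :=
  { F | ∃ p ∈ LTAres Sf Sg Sh, F = act p.1 p.2 (Sf \ Sh) }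

/-- `J_f^I(i) = {j < i : j ∉ S_f, (S_f \ {i}) ∪ {j} ∈ I}`. -/
def JfI {m : ℕ} (I : Finset (Finset (Fin m))) (Sf : Finset (Fin m)) (i : Fin m) :
    Finset (Fin m) :=
  Finset.univ.filter fun j => j < i ∧ j ∉ Sf ∧ insert j (Sf.erase i) ∈ I

/-- The orbit `LTA(m,2)_f^{f,I}·x^{S_f \ S_h}`. -/
def orbitFI {m : ℕ} (I : Finset (Finset (Fin m))) (Sf Sh : Finset (Fin m)) :
    Set (BF m) :=
  { F | ∃ B : Fin m → Fin m → ZMod 2, ∃ ε : Fin m → ZMod 2,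
      (∀ i, i ∉ Sf \ Sh → ε i = 0) ∧
      (∀ i j, B i j ≠ 0 → i ∈ Sf \ Sh ∧ j ∈ JfI I Sf i) ∧
      LinearIndependent (ZMod 2) (fun i : ((Sf \ Sh) : Finset (Fin m)) => B i.1) ∧
      F = act B ε (Sf \ Sh) }

/-- The number of linearly independent families whose members are taken from the successive steps
of an increasing chain of subspaces. -/
theorem ncard_linearIndependent_mem_monotone {K V : Type*} [Field K] [Finite K] [AddCommGroup V]
    [Module K V] [Finite V] (n : ℕ) (W : Fin n → Submodule K V) (hW : Monotone W) :
    {w : Fin n → V | (∀ j, w j ∈ W j) ∧ LinearIndependent K w}.ncard =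
      ∏ j : Fin n, (Nat.card (W j) - Nat.card K ^ (j : ℕ)) := by
  induction n with
  | zero =>
    have : {w : Fin 0 → V | (∀ j, w j ∈ W j) ∧ LinearIndependent K w} = {Fin.elim0} := by
      ext w
      simp [Subsingleton.elim w Fin.elim0]
    simp
  | succ n ih =>
    let S := {w : Fin n → V | (∀ j, w j ∈ W j.castSucc) ∧ LinearIndependent K w}
    let e : {w : Fin (n + 1) → V | (∀ j, w j ∈ W j) ∧ LinearIndependent K w} ≃
        Σ w : S, ((W (Fin.last n) : Set V) \ Submodule.span K (Set.range w.1) : Set V) :=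
      { toFun := fun w => ⟨⟨Fin.init w.1, fun j => w.2.1 _, by
            have h := w.2.2
            rw [← Fin.snoc_init_self w.1, linearIndependent_finSnoc] at h
            exact h.1⟩, w.1 (Fin.last n), w.2.1 _, by
            have h := w.2.2
            rw [← Fin.snoc_init_self w.1, linearIndependent_finSnoc] at h
            exact h.2⟩
        invFun := fun w => ⟨Fin.snoc w.1.1 w.2.1, fun j => by
            refine Fin.lastCases ?_ (fun j => ?_) j
            · simpa using w.2.2.1
            · simpa using w.1.2.1 j, linearIndependent_finSnoc.2 ⟨w.1.2.2, w.2.2.2⟩⟩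
        left_inv := fun w => by
          ext1
          exact Fin.snoc_init_self w.1
        right_inv := fun w => by
          obtain ⟨⟨w, hw⟩, x, hx⟩ := w
          have h : Fin.init (Fin.snoc w x : Fin (n + 1) → V) = w := Fin.init_snoc ..
          ext1
          · exact Subtype.ext h
          · simp }
    have hfib : ∀ w : S,
        Nat.card ((W (Fin.last n) : Set V) \ Submodule.span K (Set.range w.1) : Set V) =
          Nat.card (W (Fin.last n)) - Nat.card K ^ n := by
      intro w
      have hle : Submodule.span K (Set.range w.1) ≤ W (Fin.last n) := by
        rw [Submodule.span_le]
        rintro _ ⟨j, rfl⟩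
        exact hW (Fin.le_last _) (w.2.1 j)
      have hc : (Submodule.span K (Set.range w.1) : Set V).ncard = Nat.card K ^ n := by
        rw [← Nat.card_coe_set_eq, SetLike.coe_sort_coe,
          Module.natCard_eq_pow_finrank (K := K), finrank_span_eq_card w.2.2, Fintype.card_fin]
      rw [Nat.card_coe_set_eq, Set.ncard_sdiff hle (Set.toFinite _), hc, ← Nat.card_coe_set_eq]
      rfl
    have hS : S.ncard = _ := ih _ (hW.comp Fin.strictMono_castSucc.monotone)
    have := Fintype.ofFinite S
    rw [← Nat.card_coe_set_eq, Nat.card_congr e, Nat.card_sigma, Finset.sum_congr rfl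
      fun w _ => hfib w, Finset.sum_const, Finset.card_univ, ← Nat.card_eq_fintype_card,
      Nat.card_coe_set_eq, hS, Fin.prod_univ_castSucc,
      smul_eq_mul]
    simp

/-- All fibres of a surjective homomorphism have the same size. -/
theorem AddMonoidHom.card_mul_ncard_preimage {G M : Type*} [AddGroup G] [AddGroup M] [Finite G]
    [Finite M] (f : G →+ M) (hf : Function.Surjective f) (L : Set M) :
    Nat.card M * (f ⁻¹' L).ncard = Nat.card G * L.ncard := by
  classical
  have := Fintype.ofFinite G
  have := Fintype.ofFinite M
  have key : ∀ s : Finset M, (f ⁻¹' (s : Set M)).ncard =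
      s.card * (Finset.univ.filter fun g => f g = 0).card := by
    intro s
    have h : (f ⁻¹' (s : Set M)) = ((Finset.univ.filter fun g => f g ∈ s : Finset G) : Set G) := by
      ext; simp
    rw [h, Set.ncard_coe_finset, Finset.card_eq_sum_card_fiberwise (f := f) (t := s)
      (fun g hg => by simpa using hg), ← smul_eq_mul, ← Finset.sum_const]
    refine Finset.sum_congr rfl fun y hy => ?_
    rw [← AddMonoidHom.card_fiber_eq_of_mem_range f (hf y) (hf 0), Finset.filter_filter]
    congr 1
    ext g
    simp only [Finset.mem_filter, Finset.mem_univ, true_and, and_iff_right_iff_imp]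
    rintro rfl
    exact hy
  have hL := key (Set.toFinite L).toFinset
  have hG := key Finset.univ
  rw [Set.Finite.coe_toFinset, ← Set.ncard_eq_toFinset_card] at hL
  rw [Finset.coe_univ, Set.preimage_univ, Set.ncard_univ, Finset.card_univ] at hG
  rw [hL, hG, Nat.card_eq_fintype_card]
  ring

theorem Matrix.rank_eq_card_iff_linearIndependent_row {R m n : Type*} [Field R] [Fintype m]
    [Fintype n] (A : Matrix m n R) : A.rank = Fintype.card m ↔ LinearIndependent R A.row := by
  rw [linearIndependent_iff_card_eq_finrank_span, Matrix.rank_eq_finrank_span_row, Set.finrank,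
    eq_comm]

/-- The pair acting on a monomial can be read off from the resulting function, provided the linear
parts do not involve the variables of the monomial. -/
theorem eq_of_act_eq {m : ℕ} {T : Finset (Fin m)} {B B' : Fin m → Fin m → ZMod 2}
    {ε ε' : Fin m → ZMod 2} (hB : ∀ i ∈ T, ∀ j ∈ T, B i j = 0) (hB' : ∀ i ∈ T, ∀ j ∈ T, B' i j = 0)
    (h : act B ε T = act B' ε' T) {i : Fin m} (hi : i ∈ T) : B i = B' i ∧ ε i = ε' i := by
  have key : ∀ u : Fin m → ZMod 2, (∑ j, B i j * u j) + ε i = (∑ j, B' i j * u j) + ε' i := by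
    intro u
    let v : Fin m → ZMod 2 := fun j => if j ∈ T then 1 + (∑ k, B j k * u k) + ε j else u j
    have hsum : ∀ C : Fin m → Fin m → ZMod 2, (∀ i ∈ T, ∀ j ∈ T, C i j = 0) → ∀ k ∈ T,
        ∑ j, C k j * v j = ∑ j, C k j * u j := by
      intro C hC k hk
      refine Finset.sum_congr rfl fun j _ => ?_
      by_cases hj : j ∈ T
      · simp [hC k hk j hj]
      · simp [v, hj]
    have hv : ∀ k ∈ T, v k = 1 + (∑ j, B k j * u j) + ε k := fun k hk => by simp [v, hk]
    have h2 : ∀ a : ZMod 2, a + a = 0 := CharTwo.add_self_eq_zero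
    have h1 : act B ε T v = 1 := by
      refine Finset.prod_eq_one fun k hk => ?_
      rw [hsum B hB k hk, hv k hk]
      linear_combination h2 (∑ j, B k j * u j) + h2 (ε k)
    rw [h] at h1
    have h3 : v i + (∑ j, B' i j * v j) + ε' i ≠ 0 := by
      intro h0
      rw [act, Finset.prod_eq_zero hi h0] at h1
      exact zero_ne_one h1
    have h4 : v i + (∑ j, B' i j * v j) + ε' i = 1 := by
      revert h3
      generalize v i + (∑ j, B' i j * v j) + ε' i = a
      revert a
      decide
    rw [hsum B' hB' i hi, hv i hi] at h4
    linear_combination h4 - h2 (∑ j, B' i j * u j) - h2 (ε' i)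
  have hε : ε i = ε' i := by simpa using key 0
  refine ⟨funext fun j => ?_, hε⟩
  have := key (Pi.single j 1)
  simpa [hε, Pi.single_apply] using this

/-- The matrix supported on `P` with the given entries there. -/
def matrixOn {m : ℕ} (P : Finset (Σ _ : Fin m, Fin m)) (g : P → ZMod 2) :
    Fin m → Fin m → ZMod 2 :=
  fun i j => if h : ⟨i, j⟩ ∈ P then g ⟨⟨i, j⟩, h⟩ else 0

theorem matrixOn_apply_of_mem {m : ℕ} {P : Finset (Σ _ : Fin m, Fin m)} (g : P → ZMod 2)
    {i j : Fin m} (h : ⟨i, j⟩ ∈ P) : matrixOn P g i j = g ⟨⟨i, j⟩, h⟩ := dif_pos h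

theorem matrixOn_apply_of_notMem {m : ℕ} {P : Finset (Σ _ : Fin m, Fin m)} (g : P → ZMod 2)
    {i j : Fin m} (h : ⟨i, j⟩ ∉ P) : matrixOn P g i j = 0 := dif_neg h

theorem mem_of_matrixOn_ne_zero {m : ℕ} {P : Finset (Σ _ : Fin m, Fin m)} {g : P → ZMod 2}
    {i j : Fin m} (h : matrixOn P g i j ≠ 0) : (⟨i, j⟩ : Σ _ : Fin m, Fin m) ∈ P :=
  of_not_not fun hn => h (matrixOn_apply_of_notMem g hn)

theorem Jfg_subset_Jset {m : ℕ} (Sf Sg : Finset (Fin m)) (i : Fin m) :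
    Jfg Sf Sg i ⊆ Jset Sf i := by
  intro j
  simp only [Jfg, Jset, Finset.mem_filter, Finset.mem_union]
  tauto

theorem Jfg_mono {m : ℕ} (Sf Sg : Finset (Fin m)) : Monotone (Jfg Sf Sg) := by
  intro i i' hii' j
  simp only [Jfg, Jset, Finset.mem_filter]
  exact fun h => ⟨h.1, h.2.1.trans_le hii', h.2.2⟩

/-- The rank condition defining `LTAres` in terms of the entries at the free positions. -/
theorem rank_eq_card_iff_linearIndependent_matrixOn {m : ℕ} (Sf Sg Sh : Finset (Fin m))
    (B : Fin m → Fin m → ZMod 2) (hB : ∀ i ∈ (Sf \ Sh) ∩ Sg, ∀ j, B i j ≠ 0 → j ∈ Jset Sf i) :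
    Matrix.rank (Matrix.of fun (i : ((Sf \ Sh) ∩ Sg : Finset (Fin m)))
          (j : (Jcols Sf Sg Sh : Finset (Fin m))) => B i.1 j.1) = ((Sf \ Sh) ∩ Sg).card ↔
      LinearIndependent (ZMod 2) fun i : ((Sf \ Sh) ∩ Sg : Finset (Fin m)) =>
        matrixOn (((Sf \ Sh) ∩ Sg).sigma (Jfg Sf Sg)) (fun q => B q.1.1 q.1.2) i.1 := by
  have hinj : Function.Injective (Subtype.val : Jcols Sf Sg Sh → Fin m) := Subtype.val_injective
  let A : Matrix ((Sf \ Sh) ∩ Sg : Finset (Fin m)) (Jcols Sf Sg Sh) (ZMod 2) :=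
    Matrix.of fun i j => B i.1 j.1
  let ext0 := Function.ExtendByZero.linearMap (ZMod 2) (Subtype.val : Jcols Sf Sg Sh → Fin m)
  have hker : LinearMap.ker ext0 = ⊥ := LinearMap.ker_eq_bot.2 (Function.extend_injective hinj 0)
  have hA : A.rank = ((Sf \ Sh) ∩ Sg).card ↔ LinearIndependent (ZMod 2) (ext0 ∘ A.row) := by
    rw [LinearMap.linearIndependent_iff ext0 hker,
      ← Matrix.rank_eq_card_iff_linearIndependent_row, Fintype.card_coe]
  suffices hrow : ext0 ∘ A.row = fun i : ((Sf \ Sh) ∩ Sg : Finset (Fin m)) =>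
      matrixOn (((Sf \ Sh) ∩ Sg).sigma (Jfg Sf Sg)) (fun q => B q.1.1 q.1.2) i.1 by
    rw [hrow] at hA
    exact hA
  ext i j
  rw [Function.comp_apply, Function.ExtendByZero.linearMap_apply]
  by_cases hj : j ∈ Jcols Sf Sg Sh
  · rw [hinj.extend_apply _ _ (⟨j, hj⟩ : Jcols Sf Sg Sh)]
    by_cases hq : (⟨i.1, j⟩ : Σ _ : Fin m, Fin m) ∈ ((Sf \ Sh) ∩ Sg).sigma (Jfg Sf Sg)
    · rw [matrixOn_apply_of_mem _ hq]
      rfl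
    · rw [matrixOn_apply_of_notMem _ hq]
      by_contra h0
      have h1 := hB i.1 i.2 j h0
      refine hq (Finset.mem_sigma.2 ⟨i.2, ?_⟩)
      simp only [Jcols, Jfg, Jset, Finset.mem_filter, Finset.mem_univ, true_and] at hj h1 ⊢
      exact ⟨h1.1, hj.2⟩
  · rw [Function.extend_apply' _ _ _ (by simpa using hj), matrixOn_apply_of_notMem]
    · rfl
    · intro hq
      refine hj ?_
      have h1 := (Finset.mem_sigma.1 hq).2
      simp only [Jcols, Jfg, Jset, Finset.mem_filter, Finset.mem_univ, true_and] at h1 ⊢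
      exact ⟨⟨i.1, i.2, h1.1⟩, h1.2⟩

/-- The number of matrices with linearly independent rows whose row supports are confined to an
increasing chain of column sets. -/
theorem ncard_linearIndependent_matrixOn {m : ℕ} (H : Finset (Fin m))
    (J : Fin m → Finset (Fin m)) (hJ : Monotone J) :
    {w : H.sigma J → ZMod 2 |
      LinearIndependent (ZMod 2) fun i : H => matrixOn (H.sigma J) w i.1}.ncard =
      ∏ j : Fin H.card, (2 ^ (J (H.orderEmbOfFin rfl j)).card - 2 ^ (j : ℕ)) := by
  let e : Fin H.card ≃o H := H.orderIsoOfFin rfl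
  let W : Fin H.card → Submodule (ZMod 2) (Fin m → ZMod 2) := fun j =>
    Submodule.pi ((J (e j))ᶜ : Finset (Fin m)) fun _ => ⊥
  have hWmem : ∀ j x, x ∈ W j ↔ ∀ k, k ∉ J (e j) → x k = 0 := fun j x => by
    simp [W, Submodule.mem_pi]
  have hW : Monotone W := fun j j' hjj' x hx => by
    rw [hWmem] at hx ⊢
    exact fun k hk => hx k fun hk' => hk (hJ (e.monotone hjj') hk')
  have hWcard : ∀ j, Nat.card (W j) = 2 ^ (J (H.orderEmbOfFin rfl j)).card := by
    intro j
    have E : W j ≃ (J (e j) → ZMod 2) :=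
      { toFun := fun x k => x.1 k.1
        invFun := fun y => ⟨fun k => if h : k ∈ J (e j) then y ⟨k, h⟩ else 0,
          (hWmem _ _).2 fun k hk => dif_neg hk⟩
        left_inv := fun x => by
          ext k
          by_cases hk : k ∈ J (e j)
          · simp [hk]
          · simp [hk, (hWmem _ _).1 x.2 k hk]
        right_inv := fun y => by
          ext k
          simp }
    rw [Nat.card_congr E]
    simp [e]
  let F : (H.sigma J → ZMod 2) → Fin H.card → Fin m → ZMod 2 := fun w j =>
    matrixOn (H.sigma J) w (e j).1
  have hF : Function.Injective F := by
    intro w w' h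
    ext ⟨⟨i, j⟩, hq⟩
    have h1 := congrFun (congrFun h (e.symm ⟨i, (Finset.mem_sigma.1 hq).1⟩)) j
    simp only [F, OrderIso.apply_symm_apply] at h1
    rwa [matrixOn_apply_of_mem _ hq, matrixOn_apply_of_mem _ hq] at h1
  have hFli : ∀ w, LinearIndependent (ZMod 2) (F w) ↔
      LinearIndependent (ZMod 2) fun i : H => matrixOn (H.sigma J) w i.1 := fun w =>
    linearIndependent_equiv e.toEquiv (f := fun i : H => matrixOn (H.sigma J) w i.1)
  have himg : F '' {w | LinearIndependent (ZMod 2) fun i : H => matrixOn (H.sigma J) w i.1} =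
      {w | (∀ j, w j ∈ W j) ∧ LinearIndependent (ZMod 2) w} := by
    ext x
    constructor
    · rintro ⟨w, hw, rfl⟩
      refine ⟨fun j => (hWmem _ _).2 fun k hk => matrixOn_apply_of_notMem _ fun hq =>
        hk (Finset.mem_sigma.1 hq).2, (hFli w).2 hw⟩
    · rintro ⟨hx, hli⟩
      have hFx : F (fun q => x (e.symm ⟨q.1.1, (Finset.mem_sigma.1 q.2).1⟩) q.1.2) = x := by
        ext j k
        by_cases hk : k ∈ J (e j)
        · have hq : (⟨(e j).1, k⟩ : Σ _ : Fin m, Fin m) ∈ H.sigma J :=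
            Finset.mem_sigma.2 ⟨(e j).2, hk⟩
          simp only [F]
          rw [matrixOn_apply_of_mem _ hq]
          simp
        · rw [(hWmem _ _).1 (hx j) k hk]
          exact matrixOn_apply_of_notMem _ fun hq => hk (Finset.mem_sigma.1 hq).2
      refine ⟨_, (hFli _).1 ?_, hFx⟩
      rwa [hFx]
  rw [← Set.ncard_image_of_injective _ hF, himg, ncard_linearIndependent_mem_monotone _ W hW]
  simp [hWcard]

/-- cardinality formula for the restricted orbit
`LTA(m,2)_f^g·x^{S_f\S_h}` (cleared of denominators):
`2^{∑_j |J_{fg}(i_j)|} · |LTA(m,2)_f^g·x^{S_f\S_h}|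
  = 2^{|S_f\S_h| + |λ_{S_f}(S_f\S_h)|} · ∏_j (2^{|J_{fg}(i_j)|} − 2^{j−1})`. -/
theorem stmt10 (m : ℕ) (Sf Sg Sh : Finset (Fin m)) (hSh : Sh ⊆ Sf)
    (hcond : ∀ j : Fin ((Sf \ Sh) ∩ Sg).card,
      (j : ℕ) < (Jfg Sf Sg (((Sf \ Sh) ∩ Sg).orderEmbOfFin rfl j)).card) :
    2 ^ (∑ i ∈ (Sf \ Sh) ∩ Sg, (Jfg Sf Sg i).card) * (orbitRes Sf Sg Sh).ncard =
      2 ^ ((Sf \ Sh).card + lamOf Sf (Sf \ Sh)) *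
        ∏ j : Fin ((Sf \ Sh) ∩ Sg).card,
          (2 ^ (Jfg Sf Sg (((Sf \ Sh) ∩ Sg).orderEmbOfFin rfl j)).card -
            2 ^ (j : ℕ)) := by
  let T := Sf \ Sh
  let P := T.sigma (Jset Sf)
  let Q := (T ∩ Sg).sigma (Jfg Sf Sg)
  have hQP : Q ⊆ P := Finset.sigma_mono Finset.inter_subset_left (Jfg_subset_Jset Sf Sg)
  let φ : (P → ZMod 2) × (T → ZMod 2) →+ (Q → ZMod 2) :=
    { toFun := fun g q => g.1 ⟨q.1, hQP q.2⟩
      map_zero' := rfl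
      map_add' := fun _ _ => rfl }
  have hφ : Function.Surjective φ := by
    intro w
    refine ⟨(fun p => if h : p.1 ∈ Q then w ⟨p.1, h⟩ else 0, 0), ?_⟩
    ext q
    exact dif_pos q.2
  let L : Set (Q → ZMod 2) := {w | LinearIndependent (ZMod 2) fun i : (T ∩ Sg : Finset (Fin m)) =>
    matrixOn Q w i.1}
  let E : (T → ZMod 2) → Fin m → ZMod 2 := fun a i => if h : i ∈ T then a ⟨i, h⟩ else 0
  let A : (P → ZMod 2) × (T → ZMod 2) → BF m := fun g => act (matrixOn P g.1) (E g.2) T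
  have hPT : ∀ g : P → ZMod 2, ∀ i ∈ T, ∀ j ∈ T, matrixOn P g i j = 0 := by
    intro g i _ j hj
    refine matrixOn_apply_of_notMem _ fun hp => ?_
    have := (Finset.mem_sigma.1 hp).2
    simp only [Jset, Finset.mem_filter] at this
    exact this.2.2 (Finset.mem_sdiff.1 hj).1
  have hA : Function.Injective A := by
    intro g g' h
    have key := fun i (hi : i ∈ T) => eq_of_act_eq (hPT g.1) (hPT g'.1) h hi
    refine Prod.ext (funext fun ⟨⟨i, j⟩, hp⟩ => ?_) (funext fun ⟨i, hi⟩ => ?_)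
    · have h1 := congrFun (key i (Finset.mem_sigma.1 hp).1).1 j
      rwa [matrixOn_apply_of_mem _ hp, matrixOn_apply_of_mem _ hp] at h1
    · simpa [E, hi] using (key i hi).2
  have himg : A '' (φ ⁻¹' L) = orbitRes Sf Sg Sh := by
    ext F
    constructor
    · rintro ⟨g, hg, rfl⟩
      refine ⟨(matrixOn P g.1, E g.2), ⟨⟨fun i hi => dif_neg fun h =>
        hi (Finset.mem_sdiff.1 h).1, fun i j h => ?_⟩, ?_⟩, rfl⟩
      · have hp := Finset.mem_sigma.1 (mem_of_matrixOn_ne_zero h)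
        have h1 := hp.2
        simp only [Jset, Finset.mem_filter, Finset.mem_univ, true_and] at h1
        exact ⟨(Finset.mem_sdiff.1 hp.1).1, h1⟩
      · refine (rank_eq_card_iff_linearIndependent_matrixOn Sf Sg Sh _ fun i _ j h =>
          (Finset.mem_sigma.1 (mem_of_matrixOn_ne_zero h)).2).2 ?_
        have : (fun q : Q => matrixOn P g.1 q.1.1 q.1.2) = φ g :=
          funext fun q => matrixOn_apply_of_mem g.1 (hQP q.2)
        exact this ▸ hg
    · rintro ⟨⟨B, ε⟩, ⟨⟨_, hB⟩, hrank⟩, rfl⟩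
      have hJ : ∀ i j, B i j ≠ 0 → j ∈ Jset Sf i := fun i j h => by
        simpa [Jset] using (hB i j h).2
      refine ⟨(fun p => B p.1.1 p.1.2, fun i => ε i.1),
        (rank_eq_card_iff_linearIndependent_matrixOn Sf Sg Sh B fun i _ j => hJ i j).1 hrank, ?_⟩
      have hrow : ∀ i ∈ T, matrixOn P (fun p => B p.1.1 p.1.2) i = B i := by
        intro i hi
        ext j
        by_cases hp : (⟨i, j⟩ : Σ _ : Fin m, Fin m) ∈ P
        · exact matrixOn_apply_of_mem _ hp
        · rw [matrixOn_apply_of_notMem _ hp]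
          by_contra h
          exact hp (Finset.mem_sigma.2 ⟨hi, hJ i j (Ne.symm h)⟩)
      ext v
      refine Finset.prod_congr rfl fun i hi => ?_
      have hε : E (fun i => ε i.1) i = ε i := dif_pos hi
      simp only [hrow i hi, hε]
  have hcard := φ.card_mul_ncard_preimage hφ L
  rw [ncard_linearIndependent_matrixOn (T ∩ Sg) _ (Jfg_mono Sf Sg),
    ← Set.ncard_image_of_injective _ hA, himg] at hcard
  have hM : Nat.card (Q → ZMod 2) = 2 ^ (∑ i ∈ T ∩ Sg, (Jfg Sf Sg i).card) := by
    rw [Nat.card_fun, Nat.card_zmod, Nat.card_eq_fintype_card, Fintype.card_coe,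
      Finset.card_sigma]
  have hG : Nat.card ((P → ZMod 2) × (T → ZMod 2)) = 2 ^ (T.card + lamOf Sf T) := by
    rw [Nat.card_prod, Nat.card_fun, Nat.card_fun, Nat.card_zmod, Nat.card_eq_fintype_card,
      Nat.card_eq_fintype_card, Fintype.card_coe, Fintype.card_coe, Finset.card_sigma, pow_add,
      mul_comm, lamOf]
  rwa [hM, hG] at hcard
end

section
/- Let l, n : ℕ and let J_1 ⊆ J_2 ⊆ … ⊆ J_l be finsets of Fin n with |J_j| ≥ j for every 1 ≤ j ≤ l. Then the number of matrices M : Fin l → Fin n → ZMod 2 such that M j c = 0 whenever c ∉ J_j, and whose l rows are linearly independent over ZMod 2, equals ∏_{j=1}^{l} (2^{|J_j|} − 2^{j−1}). -/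
open Pointwise

/-- Over a finite field, the number of linearly independent families whose `j`-th vector lies in the
`j`-th term of an increasing chain of subspaces `W`. -/
theorem card_linearIndependent_of_monotone {K V : Type*} [DivisionRing K] [AddCommGroup V]
    [Module K V] [Finite K] [Finite V] {l : ℕ} (W : Fin l → Submodule K V) (hW : Monotone W) :
    Nat.card {v : Fin l → V // (∀ j, v j ∈ W j) ∧ LinearIndependent K v} =
      ∏ j : Fin l, (Nat.card (W j) - Nat.card K ^ (j : ℕ)) := by
  induction l with
  | zero =>
    have : Unique {v : Fin 0 → V // (∀ j, v j ∈ W j) ∧ LinearIndependent K v} :=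
      uniqueOfSubsingleton ⟨0, fun j => j.elim0, linearIndependent_empty_type⟩
    simp
  | succ l ih =>
    have e : {v : Fin (l + 1) → V // (∀ j, v j ∈ W j) ∧ LinearIndependent K v} ≃
        Σ v : {v : Fin l → V // (∀ j, v j ∈ W j.castSucc) ∧ LinearIndependent K v},
          ((W (Fin.last l) : Set V) \ Submodule.span K (Set.range v.1) : Set V) :=
      { toFun v := ⟨⟨Fin.init v.1, fun j => v.2.1 j.castSucc,
            (linearIndependent_finSnoc.1 ((Fin.snoc_init_self v.1).symm ▸ v.2.2)).1⟩,
          v.1 (Fin.last l), v.2.1 _,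
          (linearIndependent_finSnoc.1 ((Fin.snoc_init_self v.1).symm ▸ v.2.2)).2⟩
        invFun p := ⟨Fin.snoc p.1.1 p.2.1, fun j => by
          refine Fin.lastCases ?_ (fun i => ?_) j
          · simpa using p.2.2.1
          · simpa using p.1.2.1 i, linearIndependent_finSnoc.2 ⟨p.1.2.2, p.2.2.2⟩⟩
        left_inv v := Subtype.ext (Fin.snoc_init_self v.1)
        right_inv p := Sigma.subtype_ext
          (Subtype.ext (Fin.init_snoc (α := fun _ => V) p.2.1 p.1.1))
          (Fin.snoc_last (α := fun _ => V) p.2.1 p.1.1) }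
    have hfib (v : {v : Fin l → V // (∀ j, v j ∈ W j.castSucc) ∧ LinearIndependent K v}) :
        Nat.card ((W (Fin.last l) : Set V) \ Submodule.span K (Set.range v.1) : Set V) =
          Nat.card (W (Fin.last l)) - Nat.card K ^ l := by
      have hle : Submodule.span K (Set.range v.1) ≤ W (Fin.last l) :=
        Submodule.span_le.2 <| Set.range_subset_iff.2 fun j => hW (Fin.le_last _) (v.2.1 j)
      have hspan : Nat.card (Submodule.span K (Set.range v.1)) = Nat.card K ^ l := by
        rw [Module.natCard_eq_pow_finrank (K := K), finrank_span_eq_card v.2.2, Fintype.card_fin]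
      rw [Nat.card_coe_set_eq, Set.ncard_sdiff (SetLike.coe_subset_coe.2 hle), ← hspan]
      rfl
    have := Fintype.ofFinite
      {v : Fin l → V // (∀ j, v j ∈ W j.castSucc) ∧ LinearIndependent K v}
    rw [Nat.card_congr e, Nat.card_sigma, Finset.sum_congr rfl fun v _ => hfib v,
      Finset.sum_const, Finset.card_univ, ← Nat.card_eq_fintype_card,
      ih (fun j => W j.castSucc) fun _ _ h => hW (Fin.castSucc_le_castSucc_iff.2 h),
      Fin.prod_univ_castSucc, smul_eq_mul]
    rfl

/-- the number of matrices `M : Fin l → Fin n → ZMod 2` whose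
`j`-th row is supported on `J j` (for a nested family `J_1 ⊆ … ⊆ J_l` with
`|J_j| ≥ j`) and whose rows are linearly independent equals
`∏_{j=1}^{l} (2^{|J_j|} − 2^{j−1})`. -/
theorem stmt11 (l n : ℕ) (J : Fin l → Finset (Fin n))
    (hmono : ∀ j k : Fin l, j ≤ k → J j ⊆ J k)
    (hcard : ∀ j : Fin l, (j : ℕ) < (J j).card) :
    {M : Fin l → Fin n → ZMod 2 |
        (∀ j c, c ∉ J j → M j c = 0) ∧ LinearIndependent (ZMod 2) M}.ncard =
      ∏ j : Fin l, (2 ^ (J j).card - 2 ^ (j : ℕ)) := by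
  have hW : Monotone fun j => Pi.spanSubset (ZMod 2) (J j : Set (Fin n)) := fun j k h x hx => by
    rw [Pi.mem_spanSubset_iff] at hx ⊢
    exact fun c hc => hx c fun hc' => hc (hmono j k h hc')
  convert card_linearIndependent_of_monotone _ hW using 1
  · rw [← Nat.card_coe_set_eq]
    simp only [Pi.mem_spanSubset_iff, Finset.mem_coe]
    rfl
  · refine Finset.prod_congr rfl fun j _ => ?_
    rw [Module.natCard_eq_pow_finrank (K := ZMod 2), Pi.dim_spanSubset]
    simp
end

section
/- Let I be a decreasing family of finsets of Fin m with r = max_{T ∈ I} |T|, and let μ satisfy m − r ≥ μ and r ≥ μ ≥ 3; set w_μ = 2^{m+1−r} − 2^{m+1−r−μ}. Let S_f, S_g ∈ I_r and S_h ⊆ S_f ∩ S_g with |S_h| = r − μ; put S_{h*} = (S_f ∩ S_g) \ S_h and assume S_{h*} ≠ ∅ and that there exists a finset S* ⊆ Fin m \ (S_f ∪ S_g) with S* ≺_sh S_{h*}. Let W = {F ∈ LTA(m,2)_{S_h}·x^{S_h} · (LTA(m,2)_{S_f}·x^{S_f\S_h} + LTA(m,2)_{S_g}·x^{S_g\S_h})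 : w(F) = w_μ} and N = |LTA(m,2)_{S_h}·x^{S_h}| · |LTA(m,2)_{S_f}·x^{S_f\S_h}| · |LTA(m,2)_g^f·x^{S_g\S_h}|. Then |W| = N if S_f ≠ S_g, and 2·|W| = N if S_f = S_g. -/
open Pointwise

namespace BoolFlat

variable {m : ℕ}

theorem zmod2_ne_zero {x : ZMod 2} : x ≠ 0 ↔ x = 1 := by revert x; decide

theorem zmod2_eq_of_iff {x y : ZMod 2} (h : x = 1 ↔ y = 1) : x = y := by
  revert x y; decide

theorem zmod2_mul_eq_one {x y : ZMod 2} : x * y = 1 ↔ x = 1 ∧ y = 1 := by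
  revert x y; decide

theorem prod_eq_one_iff {ι : Type*} (T : Finset ι) (u : ι → ZMod 2) :
    ∏ i ∈ T, u i = 1 ↔ ∀ i ∈ T, u i = 1 := by
  simp only [← zmod2_ne_zero, Finset.prod_ne_zero_iff]

theorem mono_eq_one {T : Finset (Fin m)} {v : Fin m → ZMod 2} :
    mono T v = 1 ↔ ∀ i ∈ T, v i = 1 := prod_eq_one_iff T v

theorem mono_mul_mono {S T : Finset (Fin m)} (h : S ⊆ T) :
    mono S * mono (T \ S) = mono T := by
  funext v
  simp only [Pi.mul_apply, mono]
  rw [mul_comm, Finset.prod_sdiff h]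

/-- The affine map underlying the action of `(B, ε)`. -/
def affMap (B : Fin m → Fin m → ZMod 2) (ε : Fin m → ZMod 2)
    (v : Fin m → ZMod 2) : Fin m → ZMod 2 :=
  fun i => v i + (∑ j, B i j * v j) + ε i

theorem affMap_bijective {B : Fin m → Fin m → ZMod 2} (hB : ∀ i j, B i j ≠ 0 → j < i)
    (ε : Fin m → ZMod 2) : Function.Bijective (affMap B ε) := by
  rw [← Finite.injective_iff_bijective]
  intro v w h
  funext i
  induction i using WellFoundedLT.induction with
  | ind i ih =>
    have hi := congrFun h i
    have hs : ∑ j, B i j * v j = ∑ j, B i j * w j := by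
      refine Finset.sum_congr rfl fun j _ => ?_
      by_cases hj : B i j = 0
      · simp [hj]
      · rw [ih j (hB i j hj)]
    simpa [affMap, hs] using hi

theorem wt_comp {F : BF m} {σ : (Fin m → ZMod 2) → Fin m → ZMod 2}
    (hσ : Function.Bijective σ) : wt (F ∘ σ) = wt F := by
  unfold wt
  refine Finset.card_bij (fun v _ => σ v) ?_ ?_ ?_
  · intro v hv; simpa using hv
  · intro v _ w _ h; exact hσ.1 h
  · intro w hw
    obtain ⟨v, rfl⟩ := hσ.2 w
    exact ⟨v, by simpa using hw, rfl⟩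

theorem wt_add (F G : BF m) : wt (F + G) + 2 * wt (F * G) = wt F + wt G := by
  simp only [wt, Finset.card_filter, Finset.mul_sum, ← Finset.sum_add_distrib]
  refine Finset.sum_congr rfl fun v _ => ?_
  simp only [Pi.add_apply, Pi.mul_apply]
  have h01 : ∀ x : ZMod 2, x = 0 ∨ x = 1 := by decide
  have h2 : (1 : ZMod 2) + 1 = 0 := by decide
  rcases h01 (F v) with hF | hF <;> rcases h01 (G v) with hG | hG <;> simp [hF, hG, h2]

theorem card_fiber_mul_eq_iff {V W : Type*} [AddCommGroup V] [AddCommGroup W]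
    [Fintype V] [Fintype W] [DecidableEq W] (L : V →+ W) (w : W) :
    (Finset.univ.filter fun v => L v = w).card * Fintype.card W = Fintype.card V ↔
      Function.Surjective L := by
  have hV : Fintype.card V = ∑ b : W, (Finset.univ.filter fun v => L v = b).card := by
    rw [← Finset.card_univ]
    exact Finset.card_eq_sum_card_fiberwise fun _ _ => Finset.mem_coe.2 (Finset.mem_univ _)
  constructor
  · intro h b
    by_contra hb
    have hpos : 0 < Fintype.card V := Fintype.card_pos
    have hw : w ∈ Set.range L := by
      by_contra hw
      rw [Finset.filter_false_of_mem] at h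
      · simp at h; omega
      · intro v _ hv; exact hw ⟨v, hv⟩
    have hlt : Fintype.card V < ∑ _b : W, (Finset.univ.filter fun v => L v = w).card := by
      rw [hV]
      refine Finset.sum_lt_sum (fun c _ => ?_) ⟨b, Finset.mem_univ _, ?_⟩
      · by_cases hc : c ∈ Set.range L
        · exact (AddMonoidHom.card_fiber_eq_of_mem_range L hc hw).le
        · rw [Finset.filter_false_of_mem]
          · simp
          · intro v _ hv; exact hc ⟨v, hv⟩
      · rw [Finset.filter_false_of_mem]
        · obtain ⟨v, hv⟩ := hw
          exact Finset.card_pos.2 ⟨v, by simpa using hv⟩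
        · intro v _ hv; exact hb ⟨v, hv⟩
    rw [Finset.sum_const, Finset.card_univ, smul_eq_mul, mul_comm, h] at hlt
    exact lt_irrefl _ hlt
  · intro hL
    rw [hV, Finset.sum_congr rfl fun c _ =>
      AddMonoidHom.card_fiber_eq_of_mem_range L (hL c) (hL w),
      Finset.sum_const, Finset.card_univ, smul_eq_mul, mul_comm]

theorem wt_mono (T : Finset (Fin m)) : wt (mono T) = 2 ^ (m - T.card) := by
  have h := (card_fiber_mul_eq_iff
    (AddMonoidHom.mk' (fun (v : Fin m → ZMod 2) (i : T) => v i) fun _ _ => rfl)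
    (fun _ => 1)).2 (fun b => ⟨fun i => if h : i ∈ T then b ⟨i, h⟩ else 0, by
      funext i; simp⟩)
  have hset : (Finset.univ.filter fun v : Fin m → ZMod 2 =>
      AddMonoidHom.mk' (fun (v : Fin m → ZMod 2) (i : T) => v i) (fun _ _ => rfl) v =
        fun _ => 1) = Finset.univ.filter fun v => mono T v = 1 := by
    ext v
    simp [mono_eq_one, funext_iff]
  rw [hset] at h
  have hT : T.card ≤ m := by simpa using T.card_le_univ
  have h2 : wt (mono T) * 2 ^ T.card = 2 ^ (m - T.card) * 2 ^ T.card := by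
    rw [← pow_add, Nat.sub_add_cancel hT]
    simpa [wt] using h
  exact Nat.eq_of_mul_eq_mul_right (by positivity) h2

/-- `l` is an affine functional involving only coordinates from `K`. -/
def AffOn (K : Set (Fin m)) (l : BF m) : Prop :=
  ∃ (c : Fin m → ZMod 2) (e : ZMod 2), (∀ j, c j ≠ 0 → j ∈ K) ∧ ∀ v, l v = (∑ j, c j * v j) + e

theorem AffOn.mono {K K' : Set (Fin m)} {l : BF m} (h : AffOn K l) (hK : K ⊆ K') :
    AffOn K' l := by
  obtain ⟨c, e, hc, hl⟩ := h
  exact ⟨c, e, fun j hj => hK (hc j hj), hl⟩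

theorem AffOn.add {K : Set (Fin m)} {l l' : BF m} (h : AffOn K l) (h' : AffOn K l') :
    AffOn K (l + l') := by
  obtain ⟨c, e, hc, hl⟩ := h
  obtain ⟨c', e', hc', hl'⟩ := h'
  refine ⟨c + c', e + e', fun j hj => ?_, fun v => ?_⟩
  · by_contra hjK
    have h1 : c j = 0 := by_contra fun h => hjK (hc j h)
    have h2 : c' j = 0 := by_contra fun h => hjK (hc' j h)
    simp [h1, h2] at hj
  · simp only [Pi.add_apply, hl, hl', add_mul, Finset.sum_add_distrib]
    ring

theorem affOn_const (K : Set (Fin m)) (e : ZMod 2) : AffOn K fun _ => e :=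
  ⟨0, e, by simp, by simp⟩

theorem affOn_coord {K : Set (Fin m)} {i : Fin m} (hi : i ∈ K) : AffOn K fun v => v i := by
  refine ⟨Pi.single i 1, 0, fun j hj => ?_, fun v => ?_⟩
  · by_cases h : j = i
    · exact h ▸ hi
    · simp [h] at hj
  · simp [Pi.single_apply]

theorem AffOn.const_mul {K : Set (Fin m)} {l : BF m} (h : AffOn K l) (a : ZMod 2) :
    AffOn K fun v => a * l v := by
  obtain ⟨c, e, hc, hl⟩ := h
  refine ⟨fun j => a * c j, a * e, fun j hj => hc j (right_ne_zero_of_mul hj), fun v => ?_⟩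
  simp only [hl, mul_add, Finset.mul_sum, mul_assoc]

theorem AffOn.sum {K : Set (Fin m)} {ι : Type*} (s : Finset ι) {l : ι → BF m}
    (h : ∀ i ∈ s, AffOn K (l i)) : AffOn K fun v => ∑ i ∈ s, l i v := by
  classical
  induction s using Finset.induction_on with
  | empty => simpa using affOn_const K 0
  | insert a s ha ih =>
    simp only [Finset.sum_insert ha]
    exact (h a (by simp)).add (ih fun i hi => h i (by simp [hi]))

theorem AffOn.comp {K K' : Set (Fin m)} {l : BF m} (h : AffOn K l)
    {σ : (Fin m → ZMod 2) → Fin m → ZMod 2} (hσ : ∀ j ∈ K, AffOn K' fun v => σ v j) :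
    AffOn K' fun v => l (σ v) := by
  obtain ⟨c, e, hc, hl⟩ := h
  simp only [hl]
  refine AffOn.add (AffOn.sum _ fun j _ => ?_) (affOn_const K' e)
  by_cases hj : c j = 0
  · simpa [hj] using affOn_const K' 0
  · exact (hσ j (hc j hj)).const_mul _

theorem mem_orbitSub_iff {S T : Finset (Fin m)} (hT : T ⊆ S) {F : BF m} :
    F ∈ orbitSub S T ↔ ∃ l : Fin m → BF m, (∀ i ∈ T, AffOn {j | j < i ∧ j ∉ S} (l i)) ∧
      ∀ v, F v = 1 ↔ ∀ i ∈ T, v i = l i v := by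
  have key : ∀ x y e : ZMod 2, x + y + e = 1 ↔ x = y + (e + 1) := by decide
  have key' : ∀ x y e : ZMod 2, x + y + (e + 1) = 1 ↔ x = y + e := by decide
  constructor
  · rintro ⟨p, hp, rfl⟩
    refine ⟨fun i v => (∑ j, p.1 i j * v j) + (p.2 i + 1), fun i hi => ?_, fun v => ?_⟩
    · exact ⟨p.1 i, p.2 i + 1, fun j hj => (hp.2 i j hj).2, fun v => rfl⟩
    · simp only [act, prod_eq_one_iff, key]
  · rintro ⟨l, hl, hF⟩
    choose! c e hc hl using hl
    refine ⟨(fun i j => if i ∈ T then c i j else 0, fun i => if i ∈ T then e i + 1 else 0),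
      ⟨fun i hi => ?_, fun i j hij => ?_⟩, ?_⟩
    · exact if_neg fun h => hi (hT h)
    · by_cases hi : i ∈ T
      · simp only [hi, if_true] at hij
        exact ⟨hT hi, hc i hi j hij⟩
      · simp [hi] at hij
    · funext v
      refine zmod2_eq_of_iff ?_
      rw [hF, act, prod_eq_one_iff]
      refine forall₂_congr fun i hi => ?_
      simp only [hi, if_true, key', hl i hi]

theorem exists_reduced {S U : Finset (Fin m)} (l : Fin m → BF m)
    (hl : ∀ i ∈ S \ U, AffOn {j | j < i ∧ j ∉ U} (l i)) :
    ∃ l' : Fin m → BF m, (∀ i ∈ S \ U, AffOn {j | j < i ∧ j ∉ S} (l' i)) ∧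
      ∀ v, (∀ i ∈ S \ U, v i = l i v) ↔ ∀ i ∈ S \ U, v i = l' i v := by
  have key : ∀ i, i ∈ S \ U → ∃ l' : BF m, AffOn {j | j < i ∧ j ∉ S} l' ∧
      ∀ v, (∀ k ∈ S \ U, k < i → v k = l k v) → l i v = l' v := by
    intro i
    induction i using WellFoundedLT.induction with
    | ind i ih =>
      intro hi
      obtain ⟨c, e, hc, hce⟩ := hl i hi
      have sub : ∀ j, ∃ q : BF m, AffOn {j | j < i ∧ j ∉ S} q ∧
          ∀ v, (∀ k ∈ S \ U, k < i → v k = l k v) → c j * v j = q v := by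
        intro j
        by_cases hj : c j = 0
        · exact ⟨fun _ => 0, affOn_const _ 0, fun v _ => by simp [hj]⟩
        obtain ⟨hji, hjU⟩ := hc j hj
        by_cases hjS : j ∈ S
        · have hjT : j ∈ S \ U := Finset.mem_sdiff.2 ⟨hjS, hjU⟩
          obtain ⟨q, hq, hqv⟩ := ih j hji hjT
          refine ⟨fun v => c j * q v,
            (hq.mono fun k (hk : k < j ∧ k ∉ S) => (⟨hk.1.trans hji, hk.2⟩ : k < i ∧ k ∉ S)).const_mul _, fun v hv => ?_⟩
          rw [hv j hjT hji, hqv v fun k hk hkj => hv k hk (hkj.trans hji)]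
        · exact ⟨fun v => c j * v j, (affOn_coord (K := {j | j < i ∧ j ∉ S}) ⟨hji, hjS⟩).const_mul _, fun v _ => rfl⟩
      choose q hq hqv using sub
      refine ⟨(fun v => ∑ j, q j v) + fun _ => e,
        (AffOn.sum _ fun j _ => hq j).add (affOn_const _ e), fun v hv => ?_⟩
      simp only [hce, Pi.add_apply]
      rw [Finset.sum_congr rfl fun j _ => hqv j v hv]
  choose! l' hl' hv' using key
  refine ⟨l', hl', fun v => ⟨fun h i hi => ?_, fun h i hi => ?_⟩⟩
  · rw [← hv' i hi v fun k hk _ => h k hk]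
    exact h i hi
  · induction i using WellFoundedLT.induction with
    | ind i ih => rw [hv' i hi v fun k hk hki => ih k hki hk, h i hi]

theorem exists_comp_of_mem_orbitSub {S T : Finset (Fin m)} {F : BF m}
    (hF : F ∈ orbitSub S T) :
    ∃ σ : (Fin m → ZMod 2) → Fin m → ZMod 2, Function.Bijective σ ∧ F = mono T ∘ σ ∧
      (∀ v, ∀ i ∉ T, σ v i = v i) ∧
      ∀ i ∈ T, ∃ l, AffOn {j | j < i ∧ j ∉ S} l ∧ ∀ v, σ v i = v i + l v := by
  obtain ⟨p, hp, rfl⟩ := hF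
  refine ⟨affMap (fun i j => if i ∈ T then p.1 i j else 0) (fun i => if i ∈ T then p.2 i else 0),
    affMap_bijective ?_ _, ?_, ?_, ?_⟩
  · intro i j hij
    by_cases hi : i ∈ T
    · simp only [hi, if_true] at hij
      exact (hp.2 i j hij).2.1
    · simp [hi] at hij
  · funext v
    simp only [act, Function.comp, mono, affMap]
    exact Finset.prod_congr rfl fun i hi => by simp [hi]
  · intro v i hi
    simp [affMap, hi]
  · intro i hi
    refine ⟨fun v => (∑ j, p.1 i j * v j) + p.2 i,
      ⟨p.1 i, p.2 i, fun j hj => (hp.2 i j hj).2, fun _ => rfl⟩, fun v => ?_⟩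
    simp [affMap, hi, add_assoc]

theorem AffOn.congr {K : Set (Fin m)} {l : BF m} (h : AffOn K l) {v w : Fin m → ZMod 2}
    (hvw : ∀ i ∈ K, v i = w i) : l v = l w := by
  obtain ⟨c, e, hc, hl⟩ := h
  rw [hl, hl]
  congr 1
  refine Finset.sum_congr rfl fun j _ => ?_
  by_cases hj : c j = 0
  · simp [hj]
  · rw [hvw j (hc j hj)]

/-- `F` does not depend on the coordinates in `U`. -/
def IndepOf (U : Finset (Fin m)) (F : BF m) : Prop :=
  ∀ v w : Fin m → ZMod 2, (∀ i ∉ U, v i = w i) → F v = F w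

theorem IndepOf.mul {U : Finset (Fin m)} {F G : BF m} (hF : IndepOf U F) (hG : IndepOf U G) :
    IndepOf U (F * G) := fun v w h => by
  simp only [Pi.mul_apply, hF v w h, hG v w h]

theorem indepOf_of_mem_orbitSub {S U : Finset (Fin m)} (hU : U ⊆ S) {F : BF m}
    (hF : F ∈ orbitSub S (S \ U)) : IndepOf U F := by
  intro v w hvw
  obtain ⟨l, hl, hF⟩ := (mem_orbitSub_iff Finset.sdiff_subset).1 hF
  refine zmod2_eq_of_iff ?_
  rw [hF, hF]
  refine forall₂_congr fun i hi => ?_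
  rw [hvw i (Finset.mem_sdiff.1 hi).2, (hl i hi).congr fun j hj => hvw j fun h => hj.2 (hU h)]

theorem wt_mul_of_indepOf {U : Finset (Fin m)} {H F : BF m} (hH : H ∈ orbitSub U U)
    (hF : IndepOf U F) : wt (H * F) = wt (mono U * F) := by
  obtain ⟨σ, hσ, rfl, hfix, -⟩ := exists_comp_of_mem_orbitSub hH
  rw [← wt_comp (F := mono U * F) hσ]
  congr 1
  funext v
  simp only [Pi.mul_apply, Function.comp]
  rw [hF (σ v) v (hfix v)]

theorem eq_of_mul_eq_of_indepOf {U : Finset (Fin m)} {H F G : BF m} (hH : H ∈ orbitSub U U)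
    (hF : IndepOf U F) (hG : IndepOf U G) (h : H * F = H * G) : F = G := by
  obtain ⟨l, hl, hHl⟩ := (mem_orbitSub_iff subset_rfl).1 hH
  funext v
  set w : Fin m → ZMod 2 := fun i => if i ∈ U then l i v else v i with hw
  have hvw : ∀ i ∉ U, v i = w i := fun i hi => by simp [hw, hi]
  have hHw : H w = 1 := by
    rw [hHl]
    intro i hi
    rw [← (hl i hi).congr fun j hj => hvw j hj.2]
    simp [hw, hi]
  have := congrFun h w
  simp only [Pi.mul_apply, hHw, one_mul] at this
  rw [hF v w hvw, hG v w hvw, this]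

theorem comp_mem_orbitSub {S S' U : Finset (Fin m)} (hU : U ⊆ S) (hU' : U ⊆ S') {G : BF m}
    (hG : G ∈ orbitSub S' (S' \ U)) {σ : (Fin m → ZMod 2) → Fin m → ZMod 2}
    (hfix : ∀ v, ∀ i ∉ S \ U, σ v i = v i)
    (hσ : ∀ i ∈ S \ U, ∃ l, AffOn {j | j < i ∧ j ∉ S} l ∧ ∀ v, σ v i = v i + l v) :
    G ∘ σ ∈ orbitSub S' (S' \ U) := by
  have hσ' : ∀ i, ∃ l, AffOn {j | j < i ∧ j ∉ U} l ∧ ∀ v, σ v i = v i + l v := by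
    intro i
    by_cases hi : i ∈ S \ U
    · obtain ⟨l, hl, hv⟩ := hσ i hi
      exact ⟨l, hl.mono fun j (hj : j < i ∧ j ∉ S) => ⟨hj.1, fun h => hj.2 (hU h)⟩, hv⟩
    · exact ⟨fun _ => 0, affOn_const _ 0, fun v => by simp [hfix v i hi]⟩
  choose q hq hqv using hσ'
  obtain ⟨l, hl, hGl⟩ := (mem_orbitSub_iff Finset.sdiff_subset).1 hG
  have hl' : ∀ i ∈ S' \ U, AffOn {j | j < i ∧ j ∉ U} ((fun v => l i (σ v)) + q i) := by
    intro i hi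
    refine AffOn.add ((hl i hi).comp fun j hj => ?_) (hq i)
    have hjU : j ∉ U := fun h => hj.2 (hU' h)
    simp only [hqv]
    exact (affOn_coord (K := {j | j < i ∧ j ∉ U}) ⟨hj.1, hjU⟩).add
      ((hq j).mono fun k (hk : k < j ∧ k ∉ U) => ⟨hk.1.trans hj.1, hk.2⟩)
  obtain ⟨l', hl', hiff⟩ := exists_reduced _ hl'
  refine (mem_orbitSub_iff Finset.sdiff_subset).2 ⟨l', hl', fun v => ?_⟩
  rw [← hiff, Function.comp, hGl]
  refine forall₂_congr fun i _ => ?_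
  have key : ∀ x y z : ZMod 2, x + y = z ↔ x = z + y := by decide
  rw [hqv, key]
  rfl

theorem ncard_transverse {S S' U : Finset (Fin m)} (hU : U ⊆ S) (hU' : U ⊆ S') {F : BF m}
    (hF : F ∈ orbitSub S (S \ U)) (N : ℕ) :
    {G ∈ orbitSub S' (S' \ U) | wt (mono U * F * G) = N}.ncard =
      {G ∈ orbitSub S' (S' \ U) | wt (mono S * G) = N}.ncard := by
  obtain ⟨σ, hσ, rfl, hfix, haff⟩ := exists_comp_of_mem_orbitSub hF
  have hinj : Function.Injective fun G : BF m => G ∘ σ := hσ.2.injective_comp_right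
  have himg : (fun G : BF m => G ∘ σ) '' orbitSub S' (S' \ U) = orbitSub S' (S' \ U) := by
    refine Set.eq_of_subset_of_ncard_le ?_ (Set.ncard_image_of_injective _ hinj).ge
      (Set.toFinite _)
    rintro _ ⟨G, hG, rfl⟩
    exact comp_mem_orbitSub hU hU' hG hfix haff
  have hwt : ∀ G : BF m, wt (mono U * (mono (S \ U) ∘ σ) * (G ∘ σ)) = wt (mono S * G) := by
    intro G
    rw [← wt_comp (F := mono S * G) hσ, ← mono_mul_mono hU]
    congr 1
    funext v
    have : mono U (σ v) = mono U v :=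
      Finset.prod_congr rfl fun i hi => hfix v i fun h => (Finset.mem_sdiff.1 h).2 hi
    simp only [Pi.mul_apply, Function.comp, this]
  rw [← Set.ncard_image_of_injective {G ∈ orbitSub S' (S' \ U) | wt (mono S * G) = N} hinj]
  congr 1
  ext G
  constructor
  · rintro ⟨hG, hN⟩
    rw [← himg] at hG
    obtain ⟨G, hG, rfl⟩ := hG
    exact ⟨G, ⟨hG, by rw [← hwt]; exact hN⟩, rfl⟩
  · rintro ⟨G, ⟨hG, hN⟩, rfl⟩
    exact ⟨comp_mem_orbitSub hU hU' hG hfix haff, by rw [hwt]; exact hN⟩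

theorem rank_eq_card_iff {ι κ : Type*} [Fintype ι] [Fintype κ] [DecidableEq κ]
    (M : Matrix ι κ (ZMod 2)) :
    M.rank = Fintype.card ι ↔ Function.Surjective M.mulVec := by
  have : Function.Surjective M.mulVec ↔ LinearMap.range M.mulVecLin = ⊤ := by
    rw [LinearMap.range_eq_top]; rfl
  rw [this, Matrix.rank]
  constructor
  · intro h
    exact Submodule.eq_top_of_finrank_eq (by rw [h, Module.finrank_fintype_fun_eq_card])
  · intro h
    rw [h, finrank_top, Module.finrank_fintype_fun_eq_card]

theorem sum_subtype_eq_sum_dite (K : Finset (Fin m)) (q : Fin m → ZMod 2) (x : K → ZMod 2) :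
    ∑ j : K, q j * x j = ∑ j, q j * (if h : j ∈ K then x ⟨j, h⟩ else 0) := by
  rw [← Finset.sum_subset K.subset_univ fun j _ hj => by simp [hj], ← Finset.sum_coe_sort K]
  simp

theorem wt_mono_mul_act_iff {Sf Sg Sh : Finset (Fin m)}
    {p : (Fin m → Fin m → ZMod 2) × (Fin m → ZMod 2)} (hp : p ∈ LTAsub Sg) :
    wt (mono Sf * act p.1 p.2 (Sg \ Sh)) * 2 ^ (Sf.card + (Sg \ Sh).card) = 2 ^ m ↔
      p ∈ LTAres Sg Sf Sh := by
  let L : (Fin m → ZMod 2) →+ (Sf → ZMod 2) × (((Sg \ Sh : Finset (Fin m))) → ZMod 2) :=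
    AddMonoidHom.mk' (fun v => (fun i => v i, fun i => v i + ∑ j, p.1 i j * v j)) (by
      intro v w
      ext i
      · rfl
      · simp only [Pi.add_apply, Prod.snd_add, mul_add, Finset.sum_add_distrib]
        ring)
  have hL1 : ∀ v (i : Sf), (L v).1 i = v i := fun _ _ => rfl
  have hL2 : ∀ v (i : (Sg \ Sh : Finset (Fin m))), (L v).2 i = v i + ∑ j, p.1 i j * v j :=
    fun _ _ => rfl
  let w : (Sf → ZMod 2) × (((Sg \ Sh : Finset (Fin m))) → ZMod 2) :=
    (fun _ => 1, fun i => 1 + p.2 i)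
  have h1 := card_fiber_mul_eq_iff L w
  have hset : (Finset.univ.filter fun v => L v = w) =
      Finset.univ.filter fun v => (mono Sf * act p.1 p.2 (Sg \ Sh)) v = 1 := by
    ext v
    have key : ∀ x y : ZMod 2, x = 1 + y ↔ x + y = 1 := by decide
    simp only [Finset.mem_filter, Finset.mem_univ, true_and, w, Prod.ext_iff, funext_iff, hL1, hL2,
      Pi.mul_apply, zmod2_mul_eq_one, mono_eq_one, act, prod_eq_one_iff, key, Subtype.forall]
  rw [hset] at h1
  have h2 : Fintype.card ((Sf → ZMod 2) × (((Sg \ Sh : Finset (Fin m))) → ZMod 2)) =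
      2 ^ (Sf.card + (Sg \ Sh).card) := by
    simp only [Fintype.card_prod, Fintype.card_fun, ZMod.card, Fintype.card_coe, pow_add]
  have h3 : Fintype.card (Fin m → ZMod 2) = 2 ^ m := by simp
  rw [h2, h3] at h1
  rw [wt, h1, LTAres, Set.mem_sep_iff, and_iff_right hp]
  rw [← Fintype.card_coe ((Sg \ Sh) ∩ Sf), rank_eq_card_iff]
  have hcol : ∀ i ∈ (Sg \ Sh) ∩ Sf, ∀ j, j ∉ Sf → j ∉ Jcols Sg Sf Sh → p.1 i j = 0 := by
    intro i hi j hj hjJ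
    by_contra hij
    obtain ⟨-, hlt, hjg⟩ := hp.2 i j hij
    refine hjJ ?_
    simp only [Jcols, Finset.mem_filter, Finset.mem_univ, true_and, Finset.mem_union, not_or]
    exact ⟨⟨i, hi, hlt⟩, hjg, hj⟩
  have hJ : ∀ j ∈ Jcols Sg Sf Sh, j ∉ Sf := by
    intro j hj
    simp only [Jcols, Finset.mem_filter, Finset.mem_union, not_or] at hj
    exact hj.2.2.2
  constructor
  · intro hL t
    obtain ⟨v, hv⟩ := hL ((fun _ => 0),
      fun i => if h : i.1 ∈ Sf then t ⟨i, Finset.mem_inter.2 ⟨i.2, h⟩⟩ else 0)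
    have hv1 : ∀ i ∈ Sf, v i = 0 := fun i hi => congrFun (congrArg Prod.fst hv) ⟨i, hi⟩
    have hv2 := fun i => congrFun (congrArg Prod.snd hv) i
    refine ⟨fun j => v j, funext fun i => ?_⟩
    have hi := Finset.mem_inter.1 i.2
    have := hv2 ⟨i, hi.1⟩
    simp only [hL2, hi.2, dif_pos, hv1 i hi.2, zero_add] at this
    rw [← this]
    simp only [Matrix.mulVec, dotProduct, Matrix.of_apply]
    rw [sum_subtype_eq_sum_dite (Jcols Sg Sf Sh) (p.1 i) fun j => v j]
    refine Finset.sum_congr rfl fun j _ => ?_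
    by_cases hj : j ∈ Jcols Sg Sf Sh
    · simp [hj]
    · by_cases hjf : j ∈ Sf
      · simp [hv1 j hjf]
      · simp [hcol i i.2 j hjf hj]
  · rintro hM ⟨a, b⟩
    set a' : Fin m → ZMod 2 := fun j => if h : j ∈ Sf then a ⟨j, h⟩ else 0 with ha'
    obtain ⟨x, hx⟩ := hM fun i =>
      b ⟨i, (Finset.mem_inter.1 i.2).1⟩ - a' i - ∑ j, p.1 i j * a' j
    set w : Fin m → ZMod 2 := fun j => a' j + if h : j ∈ Jcols Sg Sf Sh then x ⟨j, h⟩ else 0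
      with hw
    set v : Fin m → ZMod 2 := fun i =>
      if h : i ∈ Sg \ Sh ∧ i ∉ Sf then b ⟨i, h.1⟩ - ∑ j, p.1 i j * w j else w i with hv
    have hvw : ∀ i, ∑ j, p.1 i j * v j = ∑ j, p.1 i j * w j := by
      intro i
      refine Finset.sum_congr rfl fun j _ => ?_
      by_cases hij : p.1 i j = 0
      · simp [hij]
      · have hj := (hp.2 i j hij).2.2
        simp [hv, hj]
    have hvf : ∀ i ∈ Sf, v i = a' i := by
      intro i hi
      have : i ∉ Jcols Sg Sf Sh := fun h => hJ i h hi
      simp [hv, hw, hi, this]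
    refine ⟨v, Prod.ext (funext fun i => ?_) (funext fun i => ?_)⟩
    · rw [hL1, hvf i i.2]
      simp [ha']
    · rw [hL2, hvw]
      by_cases hi : i.1 ∈ Sf
      · have hxi := congrFun hx ⟨i, Finset.mem_inter.2 ⟨i.2, hi⟩⟩
        simp only [Matrix.mulVec, dotProduct, Matrix.of_apply] at hxi
        rw [sum_subtype_eq_sum_dite (Jcols Sg Sf Sh) (p.1 i) x] at hxi
        simp only [hw, mul_add, Finset.sum_add_distrib]
        rw [hxi, hvf i hi]
        ring
      · have hvi : v i = b i - ∑ j, p.1 i j * w j := by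
          simp only [hv]
          rw [dif_pos ⟨i.2, hi⟩]
        rw [hvi]
        ring

theorem orbitRes_eq (Sf Sg Sh : Finset (Fin m)) :
    orbitRes Sg Sf Sh = {G ∈ orbitSub Sg (Sg \ Sh) |
      wt (mono Sf * G) * 2 ^ (Sf.card + (Sg \ Sh).card) = 2 ^ m} := by
  ext G
  constructor
  · rintro ⟨p, hp, rfl⟩
    exact ⟨⟨p, hp.1, rfl⟩, (wt_mono_mul_act_iff hp.1).2 hp⟩
  · rintro ⟨⟨p, hp, rfl⟩, h⟩
    exact ⟨p, (wt_mono_mul_act_iff hp).1 h, rfl⟩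

/-- The support of `F` is closed under sums of three points, i.e. an affine flat or empty. -/
def IsFlat (F : BF m) : Prop :=
  ∀ x y z, F x = 1 → F y = 1 → F z = 1 → F (x + y + z) = 1

theorem IsFlat.mul {F G : BF m} (hF : IsFlat F) (hG : IsFlat G) : IsFlat (F * G) := by
  intro x y z hx hy hz
  simp only [Pi.mul_apply, zmod2_mul_eq_one] at hx hy hz ⊢
  exact ⟨hF x y z hx.1 hy.1 hz.1, hG x y z hx.2 hy.2 hz.2⟩

theorem AffOn.map_add_add {K : Set (Fin m)} {l : BF m} (h : AffOn K l) (x y z : Fin m → ZMod 2) :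
    l (x + y + z) = l x + l y + l z := by
  obtain ⟨c, e, -, hl⟩ := h
  have key : ∀ a b c e : ZMod 2, a + b + c + e = a + e + (b + e) + (c + e) := by decide
  simp only [hl, Pi.add_apply, mul_add, Finset.sum_add_distrib]
  exact key _ _ _ _

theorem isFlat_of_mem_orbitSub {S T : Finset (Fin m)} (hT : T ⊆ S) {F : BF m}
    (hF : F ∈ orbitSub S T) : IsFlat F := by
  obtain ⟨l, hl, hF⟩ := (mem_orbitSub_iff hT).1 hF
  intro x y z hx hy hz
  rw [hF] at hx hy hz ⊢
  intro i hi
  rw [(hl i hi).map_add_add, ← hx i hi, ← hy i hi, ← hz i hi]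
  rfl

/-- The support of `F` is a coset of `D`. -/
def HasDir (F : BF m) (D : Submodule (ZMod 2) (Fin m → ZMod 2)) : Prop :=
  ∃ p, ∀ v, F v = 1 ↔ v - p ∈ D

theorem IsFlat.exists_hasDir {F : BF m} (hF : IsFlat F) (h : wt F ≠ 0) : ∃ D, HasDir F D := by
  obtain ⟨p, hp⟩ := Finset.card_ne_zero.1 h
  replace hp : F p = 1 := by simpa using hp
  refine ⟨{ carrier := {d | F (p + d) = 1}, zero_mem' := by simpa using hp,
            add_mem' := ?_, smul_mem' := ?_ }, p, fun v => ?_⟩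
  · intro a b ha hb
    have h3 := hF (p + a) (p + b) p ha hb hp
    have : p + a + (p + b) + p = p + (a + b) := by
      have key : ∀ x a b : ZMod 2, x + a + (x + b) + x = x + (a + b) := by decide
      funext i
      exact key _ _ _
    rwa [this] at h3
  · intro c d hd
    have h01 : ∀ x : ZMod 2, x = 0 ∨ x = 1 := by decide
    rcases h01 c with rfl | rfl
    · simpa using hp
    · simpa using hd
  · show F v = 1 ↔ F (p + (v - p)) = 1
    rw [add_sub_cancel]

theorem HasDir.iff_of_mem {F : BF m} {D : Submodule (ZMod 2) (Fin m → ZMod 2)} (h : HasDir F D)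
    {p : Fin m → ZMod 2} (hp : F p = 1) (v : Fin m → ZMod 2) : F v = 1 ↔ v - p ∈ D := by
  obtain ⟨q, hq⟩ := h
  have hpq := (hq p).1 hp
  rw [hq, ← sub_add_sub_cancel v p q, D.add_mem_iff_left hpq]

theorem HasDir.nonempty {F : BF m} {D : Submodule (ZMod 2) (Fin m → ZMod 2)} (h : HasDir F D) :
    ∃ v, F v = 1 := by
  obtain ⟨p, hp⟩ := h
  exact ⟨p, by simp [hp]⟩

theorem HasDir.wt_eq {F : BF m} {D : Submodule (ZMod 2) (Fin m → ZMod 2)} (h : HasDir F D) :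
    wt F = 2 ^ Module.finrank (ZMod 2) D := by
  obtain ⟨p, hp⟩ := h
  have hc : Nat.card D = 2 ^ Module.finrank (ZMod 2) D := by
    rw [Module.natCard_eq_pow_finrank (K := ZMod 2), Nat.card_zmod]
  rw [← hc, wt, ← Fintype.card_subtype, ← Nat.card_eq_fintype_card]
  exact Nat.card_congr ((Equiv.subRight p).subtypeEquiv hp)

theorem HasDir.mul {F G : BF m} {D E : Submodule (ZMod 2) (Fin m → ZMod 2)} (hF : HasDir F D)
    (hG : HasDir G E) (h : wt (F * G) ≠ 0) : HasDir (F * G) (D ⊓ E) := by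
  obtain ⟨p, hp⟩ := Finset.card_ne_zero.1 h
  replace hp : F p = 1 ∧ G p = 1 := by
    simpa [zmod2_mul_eq_one] using hp
  refine ⟨p, fun v => ?_⟩
  rw [Pi.mul_apply, zmod2_mul_eq_one, hF.iff_of_mem hp.1, hG.iff_of_mem hp.2, Submodule.mem_inf]

theorem HasDir.wt_mul_le {F G : BF m} {D E : Submodule (ZMod 2) (Fin m → ZMod 2)}
    (hF : HasDir F D) (hG : HasDir G E) :
    wt (F * G) ≤ 2 ^ Module.finrank (ZMod 2) (D ⊓ E : Submodule (ZMod 2) (Fin m → ZMod 2)) := by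
  by_cases h : wt (F * G) = 0
  · rw [h]; exact Nat.zero_le _
  · exact (hF.mul hG h).wt_eq.le

theorem HasDir.eq_of_wt_mul_ne_zero {F G : BF m} {D : Submodule (ZMod 2) (Fin m → ZMod 2)}
    (hF : HasDir F D) (hG : HasDir G D) (h : wt (F * G) ≠ 0) : F = G := by
  obtain ⟨p, hp⟩ := Finset.card_ne_zero.1 h
  replace hp : F p = 1 ∧ G p = 1 := by
    simpa [zmod2_mul_eq_one] using hp
  funext v
  exact zmod2_eq_of_iff (by rw [hF.iff_of_mem hp.1, hG.iff_of_mem hp.2])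

theorem HasDir.eq_or_wt_mul_eq_zero {F G : BF m} {D E : Submodule (ZMod 2) (Fin m → ZMod 2)}
    (hF : HasDir F D) (hG : HasDir G E)
    (hDE : Module.finrank (ZMod 2) D = Module.finrank (ZMod 2) E)
    (h : Module.finrank (ZMod 2) (D ⊓ E : Submodule (ZMod 2) (Fin m → ZMod 2)) =
      Module.finrank (ZMod 2) D) : F = G ∨ wt (F * G) = 0 := by
  have h1 : D ⊓ E = D := Submodule.eq_of_le_of_finrank_eq inf_le_left h
  have h2 : D = E := Submodule.eq_of_le_of_finrank_eq (inf_eq_left.1 h1) hDE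
  subst h2
  by_cases h0 : wt (F * G) = 0
  · exact Or.inr h0
  · exact Or.inl (hF.eq_of_wt_mul_ne_zero hG h0)

theorem wt_le_of_add_eq_add {F G F' G' : BF m} (h : F + G = F' + G') :
    wt F ≤ wt (F * G) + wt (F * F') + wt (F * G') := by
  simp only [wt]
  refine (Finset.card_le_card ?_).trans
    ((Finset.card_union_le _ _).trans (Nat.add_le_add_right (Finset.card_union_le _ _) _))
  intro v hv
  have hv' := congrFun h v
  simp only [Pi.add_apply] at hv'
  simp only [Finset.mem_union, Finset.mem_filter, Finset.mem_univ, true_and, Pi.mul_apply,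
    zmod2_mul_eq_one] at hv ⊢
  rw [hv] at hv'
  have key : ∀ a b c : ZMod 2, 1 + a = b + c → a = 1 ∨ b = 1 ∨ c = 1 := by decide
  have := key _ _ _ hv'
  tauto

theorem eq_or_eq_of_add_eq_add {F G F' G' : BF m}
    {A A' B' : Submodule (ZMod 2) (Fin m → ZMod 2)} {x t : ℕ}
    (hF : HasDir F A) (hF' : HasDir F' A') (hG' : HasDir G' B')
    (hA : Module.finrank (ZMod 2) A = x) (hA' : Module.finrank (ZMod 2) A' = x)
    (hB' : Module.finrank (ZMod 2) B' = x) (hFG : wt (F * G) = 2 ^ t)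
    (hFG' : wt (F' * G') = 2 ^ t) (htx : t + 3 ≤ x) (h : F + G = F' + G') :
    F = F' ∨ F = G' := by
  have hle := wt_le_of_add_eq_add h
  rw [hF.wt_eq, hA, hFG] at hle
  have ht := (hF'.mul hG' (by rw [hFG']; positivity)).wt_eq
  rw [hFG'] at ht
  replace ht := Nat.pow_right_injective le_rfl ht
  have hy := hF.wt_mul_le hF'
  have hz := hF.wt_mul_le hG'
  have hyx : Module.finrank (ZMod 2) (A ⊓ A' : Submodule (ZMod 2) (Fin m → ZMod 2)) ≤ x :=
    hA ▸ Submodule.finrank_mono inf_le_left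
  have hzx : Module.finrank (ZMod 2) (A ⊓ B' : Submodule (ZMod 2) (Fin m → ZMod 2)) ≤ x :=
    hA ▸ Submodule.finrank_mono inf_le_left
  have hsum := Submodule.finrank_sup_add_finrank_inf_eq (A ⊓ A') (A ⊓ B')
  have hs : Module.finrank (ZMod 2)
      ((A ⊓ A') ⊔ (A ⊓ B') : Submodule (ZMod 2) (Fin m → ZMod 2)) ≤ x :=
    hA ▸ Submodule.finrank_mono (sup_le inf_le_left inf_le_left)
  have hi : Module.finrank (ZMod 2)
      ((A ⊓ A') ⊓ (A ⊓ B') : Submodule (ZMod 2) (Fin m → ZMod 2)) ≤ t :=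
    ht ▸ Submodule.finrank_mono (inf_le_inf inf_le_right inf_le_right)
  have e1 := hF.eq_or_wt_mul_eq_zero hF' (hA.trans hA'.symm)
  have e2 := hF.eq_or_wt_mul_eq_zero hG' (hA.trans hB'.symm)
  rw [hA] at e1 e2
  generalize Module.finrank (ZMod 2) (A ⊓ A' : Submodule (ZMod 2) (Fin m → ZMod 2)) = y at *
  generalize Module.finrank (ZMod 2) (A ⊓ B' : Submodule (ZMod 2) (Fin m → ZMod 2)) = z at *
  obtain ⟨k, rfl⟩ : ∃ k, x = k + 3 := ⟨x - 3, by omega⟩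
  have p3 : 2 ^ (k + 3) = 8 * 2 ^ k := by ring
  have hpos : 0 < 2 ^ k := by positivity
  have htk : 2 ^ t ≤ 2 ^ k := Nat.pow_le_pow_right two_pos (by omega)
  have bound : ∀ a b, a ≤ k + b → 2 ^ a ≤ 2 ^ k * 2 ^ b := fun a b hab => by
    rw [← pow_add]; exact Nat.pow_le_pow_right two_pos hab
  by_cases hy3 : y = k + 3
  · rcases e1 hy3 with e | e
    · exact Or.inl e
    · have := bound z 0 (by omega)
      omega
  by_cases hz3 : z = k + 3
  · rcases e2 hz3 with e | e
    · exact Or.inr e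
    · have := bound y 0 (by omega)
      omega
  exfalso
  by_cases hy2 : y = k + 2
  · have h1 := bound y 2 (by omega)
    have h2 := bound z 1 (by omega)
    omega
  · have h1 := bound y 1 (by omega)
    have h2 := bound z 2 (by omega)
    omega

theorem eq_of_spanning_flats {H H' F G : BF m} (hH : IsFlat H) (hH' : IsFlat H')
    (hF : IsFlat F) (hG : IsFlat G) {a b t : ℕ} (hwH : wt H = 2 ^ b) (hwH' : wt H' = 2 ^ b)
    (hwF : wt F = 2 ^ a) (hwG : wt G = 2 ^ a) (hwFG : wt (F * G) = 2 ^ t) (hb : b + t = a + a)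
    (hFH : ∀ v, F v = 1 → H v = 1 ∧ H' v = 1) (hGH : ∀ v, G v = 1 → H v = 1 ∧ H' v = 1) :
    H = H' := by
  have ne : ∀ {k}, (2 : ℕ) ^ k ≠ 0 := fun {k} => by positivity
  obtain ⟨C, hC⟩ := hH.exists_hasDir (by rw [hwH]; exact ne)
  obtain ⟨C', hC'⟩ := hH'.exists_hasDir (by rw [hwH']; exact ne)
  obtain ⟨A, hA⟩ := hF.exists_hasDir (by rw [hwF]; exact ne)
  obtain ⟨B, hB⟩ := hG.exists_hasDir (by rw [hwG]; exact ne)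
  have hAB := hA.mul hB (by rw [hwFG]; exact ne)
  have dim : ∀ {P : BF m} {D k}, HasDir P D → wt P = 2 ^ k → Module.finrank (ZMod 2) D = k :=
    fun hP hk => Nat.pow_right_injective le_rfl (hP.wt_eq.symm.trans hk)
  have le : ∀ {P Q : BF m} {D E}, HasDir P D → HasDir Q E → (∀ v, P v = 1 → Q v = 1) → D ≤ E := by
    intro P Q D E hP hQ hPQ d hd
    obtain ⟨p, hp⟩ := hP.nonempty
    have h1 : P (p + d) = 1 := (hP.iff_of_mem hp _).2 (by simpa using hd)
    simpa using (hQ.iff_of_mem (hPQ _ hp) _).1 (hPQ _ h1)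
  have hsum := Submodule.finrank_sup_add_finrank_inf_eq A B
  rw [dim hA hwF, dim hB hwG, dim hAB hwFG] at hsum
  have h1 : A ⊔ B = C := Submodule.eq_of_le_of_finrank_eq
    (sup_le (le hA hC fun v hv => (hFH v hv).1) (le hB hC fun v hv => (hGH v hv).1))
    (by rw [dim hC hwH]; omega)
  have h2 : A ⊔ B = C' := Submodule.eq_of_le_of_finrank_eq
    (sup_le (le hA hC' fun v hv => (hFH v hv).2) (le hB hC' fun v hv => (hGH v hv).2))
    (by rw [dim hC' hwH']; omega)
  rw [← h1] at hC
  rw [← h2] at hC'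
  obtain ⟨p, hp⟩ := hA.nonempty
  refine hC.eq_of_wt_mul_ne_zero hC' (Finset.card_ne_zero.2 ⟨p, ?_⟩)
  simp [(hFH p hp).1, (hFH p hp).2]

theorem eq_of_mem_orbitSub {S S' U : Finset (Fin m)} (hcard : S.card = S'.card) (hU : U ⊆ S')
    {F : BF m} (hF : F ∈ orbitSub S (S \ U)) (hF' : F ∈ orbitSub S' (S' \ U)) : S = S' := by
  by_contra hne
  obtain ⟨i, hi, hi'⟩ : ∃ i ∈ S, i ∉ S' := by
    by_contra! h
    exact hne (Finset.eq_of_subset_of_card_le h hcard.ge)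
  have hiU : i ∉ U := fun h => hi' (hU h)
  obtain ⟨l, hl, hFl⟩ := (mem_orbitSub_iff Finset.sdiff_subset).1 hF
  obtain ⟨l', hl', hFl'⟩ := (mem_orbitSub_iff Finset.sdiff_subset).1 hF'
  obtain ⟨v, hv⟩ : ∃ v, F v = 1 := by
    obtain ⟨σ, hσ, rfl, -⟩ := exists_comp_of_mem_orbitSub hF'
    obtain ⟨v, hv⟩ := hσ.2 fun _ => 1
    exact ⟨v, by simp [hv, mono]⟩
  set u : Fin m → ZMod 2 := Function.update v i (v i + 1) with hu
  set w : Fin m → ZMod 2 := fun j => if j ∈ S' \ U then l' j u else u j with hw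
  have hwF : F w = 1 := by
    rw [hFl']
    intro j hj
    have : l' j w = l' j u := (hl' j hj).congr fun k hk =>
      if_neg fun h => hk.2 (Finset.mem_sdiff.1 h).1
    rw [this]
    exact if_pos hj
  have hwv : ∀ j, j < i → w j = v j := by
    intro j hj
    by_cases hjT : j ∈ S' \ U
    · have h1 : l' j u = l' j v := (hl' j hjT).congr fun k hk =>
        Function.update_of_ne (hk.1.trans hj).ne _ _
      rw [(hFl' v).1 hv j hjT, ← h1]
      exact if_pos hjT
    · have : w j = u j := if_neg hjT
      rw [this]
      exact Function.update_of_ne hj.ne _ _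
  have hiT : i ∈ S \ U := Finset.mem_sdiff.2 ⟨hi, hiU⟩
  have h1 : w i = v i := by
    rw [(hFl w).1 hwF i hiT, (hFl v).1 hv i hiT]
    exact (hl i hiT).congr fun k hk => hwv k hk.1
  have h2 : w i = v i + 1 := by
    have : w i = u i := if_neg fun h => hi' (Finset.mem_sdiff.1 h).1
    rw [this, hu, Function.update_self]
  simp [h2] at h1

theorem wt_mul_of_mem_orbitSub {S U : Finset (Fin m)} (hU : U ⊆ S) {H F : BF m}
    (hH : H ∈ orbitSub U U) (hF : F ∈ orbitSub S (S \ U)) : wt (H * F) = 2 ^ (m - S.card) := by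
  rw [wt_mul_of_indepOf hH (indepOf_of_mem_orbitSub hU hF)]
  obtain ⟨σ, hσ, rfl, hfix, -⟩ := exists_comp_of_mem_orbitSub hF
  rw [← wt_mono, ← wt_comp (F := mono S) hσ, ← mono_mul_mono hU]
  congr 1
  funext v
  have : mono U (σ v) = mono U v :=
    Finset.prod_congr rfl fun i hi => hfix v i fun h => (Finset.mem_sdiff.1 h).2 hi
  simp only [Pi.mul_apply, Function.comp, this]

theorem wt_of_mem_orbitSub {S T : Finset (Fin m)} {F : BF m} (hF : F ∈ orbitSub S T) :
    wt F = 2 ^ (m - T.card) := by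
  obtain ⟨σ, hσ, rfl, -⟩ := exists_comp_of_mem_orbitSub hF
  rw [wt_comp hσ, wt_mono]

theorem mul_self_eq (F : BF m) : F * F = F := by
  have key : ∀ x : ZMod 2, x * x = x := by decide
  exact funext fun v => key (F v)

theorem mul_mul_mul_left_eq (H F G : BF m) : (H * F) * (H * G) = H * (F * G) := by
  rw [mul_mul_mul_comm, mul_self_eq]

theorem ncard_prod_sep {α β : Type*} [Finite α] [Finite β] (A : Set α) (B : Set β)
    (R : α → β → Prop) (N : ℕ) (h : ∀ a ∈ A, {b ∈ B | R a b}.ncard = N) :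
    {x : α × β | x.1 ∈ A ∧ x.2 ∈ B ∧ R x.1 x.2}.ncard = A.ncard * N := by
  classical
  have e : {x : α × β | x.1 ∈ A ∧ x.2 ∈ B ∧ R x.1 x.2} ≃ Σ a : A, {b ∈ B | R a b} :=
    { toFun := fun x => ⟨⟨x.1.1, x.2.1⟩, ⟨x.1.2, x.2.2⟩⟩
      invFun := fun y => ⟨(y.1.1, y.2.1), y.1.2, y.2.2⟩
      left_inv := fun _ => rfl
      right_inv := fun _ => rfl }
  have := Fintype.ofFinite A
  rw [← Nat.card_coe_set_eq, Nat.card_congr e, Nat.card_sigma,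
    Finset.sum_congr rfl fun (a : A) _ => (Nat.card_coe_set_eq _).trans (h a a.2), Finset.sum_const,
    Finset.card_univ, smul_eq_mul, ← Nat.card_eq_fintype_card, Nat.card_coe_set_eq]

theorem two_mul_ncard_image {α β : Type*} [Finite α] (T : Set α) (φ : α → β) (s : α → α)
    (hs : ∀ a ∈ T, s a ∈ T) (hne : ∀ a ∈ T, s a ≠ a) (hφ : ∀ a ∈ T, φ (s a) = φ a)
    (hinj : ∀ a ∈ T, ∀ b ∈ T, φ a = φ b → b = a ∨ b = s a) :
    2 * (φ '' T).ncard = T.ncard := by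
  classical
  have := Fintype.ofFinite α
  obtain ⟨T, rfl⟩ : ∃ T' : Finset α, T = T' := ⟨T.toFinset, by simp⟩
  rw [← Finset.coe_image, Set.ncard_coe_finset, Set.ncard_coe_finset,
    Finset.card_eq_sum_card_image φ T, Finset.sum_congr rfl (g := fun _ => 2),
    Finset.sum_const, smul_eq_mul, mul_comm]
  intro c hc
  obtain ⟨a, ha, rfl⟩ := Finset.mem_image.1 hc
  rw [← Finset.card_pair (hne a ha).symm]
  congr 1
  ext b
  simp only [Finset.mem_filter, Finset.mem_insert, Finset.mem_singleton]
  constructor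
  · rintro ⟨hb, hab⟩
    exact hinj a ha b hb hab.symm
  · rintro (rfl | rfl)
    · exact ⟨ha, rfl⟩
    · exact ⟨hs a ha, hφ a ha⟩

/-- The triples `(h, f, g)` with `h * (f + g)` of the prescribed weight. -/
def transverseTriples (Sf Sg Sh : Finset (Fin m)) (N : ℕ) : Set (BF m × BF m × BF m) :=
  orbitSub Sh Sh ×ˢ {x | x.1 ∈ orbitSub Sf (Sf \ Sh) ∧ x.2 ∈ orbitSub Sg (Sg \ Sh) ∧
    wt (mono Sh * x.1 * x.2) = N}

theorem ncard_transverseTriples {Sf Sg Sh : Finset (Fin m)} (hf : Sh ⊆ Sf) (hg : Sh ⊆ Sg)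
    (hm : Sf.card + (Sg \ Sh).card ≤ m) :
    (transverseTriples Sf Sg Sh (2 ^ (m - (Sf.card + (Sg \ Sh).card)))).ncard =
      (orbitSub Sh Sh).ncard * (orbitSub Sf (Sf \ Sh)).ncard * (orbitRes Sg Sf Sh).ncard := by
  rw [transverseTriples, Set.ncard_prod, mul_assoc,
    ncard_prod_sep (orbitSub Sf (Sf \ Sh)) (orbitSub Sg (Sg \ Sh))
      (fun F G => wt (mono Sh * F * G) = _) _ fun F hF => ncard_transverse hf hg hF _]
  congr 3
  rw [orbitRes_eq]
  ext G
  simp only [Set.mem_sep_iff, and_congr_right_iff]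
  intro _
  have h2m : 2 ^ m = 2 ^ (m - (Sf.card + (Sg \ Sh).card)) * 2 ^ (Sf.card + (Sg \ Sh).card) := by
    rw [← pow_add, Nat.sub_add_cancel hm]
  rw [h2m]
  exact (Nat.mul_left_inj (by positivity)).symm

theorem wt_mul_add_eq_iff {Sf Sg Sh : Finset (Fin m)} (hf : Sh ⊆ Sf) (hg : Sh ⊆ Sg)
    (hfg : Sf.card = Sg.card) (hm : Sf.card ≤ m) {k : ℕ} (hk : k ≤ m - Sf.card) {H F G : BF m}
    (hH : H ∈ orbitSub Sh Sh) (hF : F ∈ orbitSub Sf (Sf \ Sh)) (hG : G ∈ orbitSub Sg (Sg \ Sh)) :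
    wt (H * (F + G)) = 2 ^ (m + 1 - Sf.card) - 2 ^ (k + 1) ↔ wt (mono Sh * F * G) = 2 ^ k := by
  have h := wt_add (H * F) (H * G)
  rw [← mul_add, mul_mul_mul_left_eq, wt_mul_of_mem_orbitSub hf hH hF,
    wt_mul_of_mem_orbitSub hg hH hG, ← hfg, wt_mul_of_indepOf hH
      ((indepOf_of_mem_orbitSub hf hF).mul (indepOf_of_mem_orbitSub hg hG)), ← mul_assoc] at h
  have h1 : 2 ^ (m + 1 - Sf.card) = 2 * 2 ^ (m - Sf.card) := by
    rw [← pow_succ', Nat.sub_add_comm hm]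
  have h2 : 2 ^ (k + 1) = 2 * 2 ^ k := pow_succ' 2 k
  have h3 : 2 ^ k ≤ 2 ^ (m - Sf.card) := Nat.pow_le_pow_right two_pos hk
  omega

theorem eq_or_swap_of_mul_add_eq {Sf Sg Sh : Finset (Fin m)} (hf : Sh ⊆ Sf) (hg : Sh ⊆ Sg)
    (hfg : Sf.card = Sg.card) {k μ : ℕ} (hμ : 3 ≤ μ) (hm : m - Sf.card = k + μ)
    (hSh : m - Sh.card = k + μ + μ) {a b : BF m × BF m × BF m}
    (ha : a ∈ transverseTriples Sf Sg Sh (2 ^ k)) (hb : b ∈ transverseTriples Sf Sg Sh (2 ^ k))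
    (hab : a.1 * (a.2.1 + a.2.2) = b.1 * (b.2.1 + b.2.2)) :
    b = a ∨ b = (a.1, a.2.2, a.2.1) := by
  obtain ⟨H, F, G⟩ := a
  obtain ⟨H', F', G'⟩ := b
  obtain ⟨hH, hF, hG, hFG⟩ := ha
  obtain ⟨hH', hF', hG', hFG'⟩ := hb
  dsimp only at *
  have iF := indepOf_of_mem_orbitSub hf hF
  have iG := indepOf_of_mem_orbitSub hg hG
  have iF' := indepOf_of_mem_orbitSub hf hF'
  have iG' := indepOf_of_mem_orbitSub hg hG'
  have lH := isFlat_of_mem_orbitSub subset_rfl hH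
  have lH' := isFlat_of_mem_orbitSub subset_rfl hH'
  have lHF := lH.mul (isFlat_of_mem_orbitSub Finset.sdiff_subset hF)
  have lHG := lH.mul (isFlat_of_mem_orbitSub Finset.sdiff_subset hG)
  have lHF' := lH'.mul (isFlat_of_mem_orbitSub Finset.sdiff_subset hF')
  have lHG' := lH'.mul (isFlat_of_mem_orbitSub Finset.sdiff_subset hG')
  have wH := wt_of_mem_orbitSub hH
  have wH' := wt_of_mem_orbitSub hH'
  have wHF := wt_mul_of_mem_orbitSub hf hH hF
  have wHG := wt_mul_of_mem_orbitSub hg hH hG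
  have wHF' := wt_mul_of_mem_orbitSub hf hH' hF'
  have wHG' := wt_mul_of_mem_orbitSub hg hH' hG'
  rw [← hfg] at wHG wHG'
  rw [hm] at wHF wHG wHF' wHG'
  rw [hSh] at wH wH'
  have wHFG : wt (H * F * (H * G)) = 2 ^ k := by
    rw [mul_mul_mul_left_eq, wt_mul_of_indepOf hH (iF.mul iG), ← mul_assoc, hFG]
  have wHFG' : wt (H' * F' * (H' * G')) = 2 ^ k := by
    rw [mul_mul_mul_left_eq, wt_mul_of_indepOf hH' (iF'.mul iG'), ← mul_assoc, hFG']
  rw [mul_add, mul_add] at hab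
  have ne : (2 : ℕ) ^ (k + μ) ≠ 0 := by positivity
  obtain ⟨A, hA⟩ := lHF.exists_hasDir (by rw [wHF]; exact ne)
  obtain ⟨A', hA'⟩ := lHF'.exists_hasDir (by rw [wHF']; exact ne)
  obtain ⟨B', hB'⟩ := lHG'.exists_hasDir (by rw [wHG']; exact ne)
  have dim : ∀ {P : BF m} {D}, HasDir P D → wt P = 2 ^ (k + μ) →
      Module.finrank (ZMod 2) D = k + μ :=
    fun hP hk => Nat.pow_right_injective le_rfl (hP.wt_eq.symm.trans hk)
  have supp : ∀ {P Q : BF m} (v), (P * Q) v = 1 → P v = 1 := fun v hv =>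
    (zmod2_mul_eq_one.1 hv).1
  rcases eq_or_eq_of_add_eq_add hA hA' hB' (dim hA wHF) (dim hA' wHF') (dim hB' wHG') wHFG wHFG'
    (by omega) hab with h | h
  · have h' : H * G = H' * G' := by
      rw [h] at hab
      exact add_left_cancel hab
    obtain rfl : H = H' := eq_of_spanning_flats lH lH' lHF lHG wH wH' wHF wHG wHFG (by omega)
      (fun v hv => ⟨supp v hv, supp v (h ▸ hv)⟩) (fun v hv => ⟨supp v hv, supp v (h' ▸ hv)⟩)
    obtain rfl := eq_of_mul_eq_of_indepOf hH iF iF' h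
    obtain rfl := eq_of_mul_eq_of_indepOf hH iG iG' h'
    exact Or.inl rfl
  · have h' : H * G = H' * F' := by
      rw [h, add_comm] at hab
      exact add_right_cancel hab
    obtain rfl : H = H' := eq_of_spanning_flats lH lH' lHF lHG wH wH' wHF wHG wHFG (by omega)
      (fun v hv => ⟨supp v hv, supp v (h ▸ hv)⟩) (fun v hv => ⟨supp v hv, supp v (h' ▸ hv)⟩)
    obtain rfl := eq_of_mul_eq_of_indepOf hH iF iG' h
    obtain rfl := eq_of_mul_eq_of_indepOf hH iG iF' h'
    exact Or.inr rfl

end BoolFlat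

/-- sub-case A.2: with `S_h ⊆ S_f ∩ S_g`, `|S_h| = r − μ`,
`S_{h*} = (S_f ∩ S_g) \ S_h ≠ ∅` and a shift witness `S* ≺_sh S_{h*}` disjoint
from `S_f ∪ S_g`, the number of weight-`w_μ` elements of the orbit equals
`|LTA(m,2)_{S_h}·x^{S_h}| · |LTA(m,2)_{S_f}·x^{S_f\S_h}| · |LTA(m,2)_g^f·x^{S_g\S_h}|`
when `S_f ≠ S_g`, and half of it when `S_f = S_g`. -/
theorem stmt13 (m r μ : ℕ) (I : Finset (Finset (Fin m))) (hI : Decreasing I)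
    (hmax : ∀ T ∈ I, T.card ≤ r) (hex : ∃ T ∈ I, T.card = r)
    (hμ3 : 3 ≤ μ) (hμr : μ ≤ r) (hrm : μ ≤ m - r)
    (Sf Sg : Finset (Fin m)) (hf : Sf ∈ I) (hfc : Sf.card = r)
    (hg : Sg ∈ I) (hgc : Sg.card = r)
    (Sh : Finset (Fin m)) (hSh : Sh ⊆ Sf ∩ Sg) (hShc : Sh.card = r - μ)
    (hne : ((Sf ∩ Sg) \ Sh).Nonempty)
    (hshift : ∃ Sstar : Finset (Fin m), Disjoint Sstar (Sf ∪ Sg) ∧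
      shLT Sstar ((Sf ∩ Sg) \ Sh)) :
    (Sf ≠ Sg →
      {F ∈ orbitSub Sh Sh *
          (orbitSub Sf (Sf \ Sh) + orbitSub Sg (Sg \ Sh)) |
        wt F = 2 ^ (m + 1 - r) - 2 ^ (m + 1 - r - μ)}.ncard =
      (orbitSub Sh Sh).ncard * (orbitSub Sf (Sf \ Sh)).ncard *
        (orbitRes Sg Sf Sh).ncard) ∧
    (Sf = Sg →
      2 * {F ∈ orbitSub Sh Sh *
          (orbitSub Sf (Sf \ Sh) + orbitSub Sg (Sg \ Sh)) |
        wt F = 2 ^ (m + 1 - r) - 2 ^ (m + 1 - r - μ)}.ncard =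
      (orbitSub Sh Sh).ncard * (orbitSub Sf (Sf \ Sh)).ncard *
        (orbitRes Sg Sf Sh).ncard) := by
  have hShf : Sh ⊆ Sf := hSh.trans Finset.inter_subset_left
  have hShg : Sh ⊆ Sg := hSh.trans Finset.inter_subset_right
  have hcard : Sf.card = Sg.card := hfc.trans hgc.symm
  have hTg : (Sg \ Sh).card = μ := by
    rw [Finset.card_sdiff_of_subset hShg]
    omega
  have hW : {F ∈ orbitSub Sh Sh * (orbitSub Sf (Sf \ Sh) + orbitSub Sg (Sg \ Sh)) |
      wt F = 2 ^ (m + 1 - r) - 2 ^ (m + 1 - r - μ)} =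
      (fun t : BF m × BF m × BF m => t.1 * (t.2.1 + t.2.2)) ''
        BoolFlat.transverseTriples Sf Sg Sh (2 ^ (m - (r + μ))) := by
    have hk : m + 1 - r - μ = m - (r + μ) + 1 := by omega
    have key := fun {H F G : BF m} => BoolFlat.wt_mul_add_eq_iff (H := H) (F := F) (G := G)
      hShf hShg hcard (by omega) (k := m - (r + μ)) (by omega)
    rw [hfc] at key
    rw [hk]
    ext P
    constructor
    · rintro ⟨⟨H, hH, _, ⟨F, hF, G, hG, rfl⟩, rfl⟩, hwt⟩
      exact ⟨(H, F, G), ⟨hH, hF, hG, (key hH hF hG).1 hwt⟩, rfl⟩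
    · rintro ⟨⟨H, F, G⟩, ⟨hH, hF, hG, hwt⟩, rfl⟩
      exact ⟨Set.mul_mem_mul hH (Set.add_mem_add hF hG), (key hH hF hG).2 hwt⟩
  have hN := BoolFlat.ncard_transverseTriples hShf hShg (by omega)
  rw [hfc, hTg] at hN
  have huniq := fun {a b : BF m × BF m × BF m} => BoolFlat.eq_or_swap_of_mul_add_eq
    (a := a) (b := b) hShf hShg hcard hμ3 (k := m - (r + μ)) (by omega) (by omega)
  rw [hW, ← hN]
  refine ⟨fun hne => Set.InjOn.ncard_image fun a ha b hb hab => ?_, fun heq => ?_⟩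
  · rcases huniq ha hb hab with h | h
    · exact h.symm
    · refine absurd (BoolFlat.eq_of_mem_orbitSub hcard hShg ha.2.1 ?_) hne
      have h2 : b.2.2 = a.2.1 := by rw [h]
      exact h2 ▸ hb.2.2.1
  · subst heq
    refine BoolFlat.two_mul_ncard_image _ _ (fun a => (a.1, a.2.2, a.2.1)) ?_ ?_ ?_
      fun a ha b hb hab => huniq ha hb hab
    · rintro ⟨H, F, G⟩ ⟨hH, hF, hG, hwt⟩
      exact ⟨hH, hG, hF, by rw [← hwt, mul_right_comm]⟩
    · rintro ⟨H, F, G⟩ ⟨hH, hF, hG, hwt⟩ h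
      obtain rfl : G = F := congrArg (fun t => t.2.1) h
      dsimp only at hwt hF hH
      rw [mul_assoc, BoolFlat.mul_self_eq, ← BoolFlat.wt_mul_of_indepOf hH
        (BoolFlat.indepOf_of_mem_orbitSub hShf hF),
        BoolFlat.wt_mul_of_mem_orbitSub hShf hH hF] at hwt
      have := Nat.pow_right_injective le_rfl hwt
      omega
    · intro a _
      simp only [add_comm]
end

section
/- Let I be a decreasing family of finsets of Fin m with r = max_{T ∈ I} |T|, and let μ satisfy m − r ≥ μ and r ≥ μ ≥ 3. Let S_f, S_g, S_{f′}, S_{g′} ∈ I_r with |S_f ∩ S_g| = |S_{f′} ∩ S_{g′}| = r − μ, and suppose that the unordered pairs {S_f, S_g} and {S_{f′}, S_{g′}} are distinct. Set S_h = S_f ∩ S_g and S_{h′} = S_{f′} ∩ S_{g′}. Then the sets LTA(m,2)_{S_h}·x^{S_h} · (LTA(m,2)_{S_f}·x^{S_f\S_h} + LTA(m,2)_{S_g}·x^{S_g\S_h}) and LTA(m,2)_{S_{h′}}·x^{S_{h′}} · (LTA(m,2)_{S_{f′}}·x^{S_{f′}\S_{h′}} + LTA(m,2)_{S_{g′}}·x^{S_{g′}\S_{h′}})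 are disjoint. -/
open Pointwise

/-! ### Cosets in a finite abelian group -/

/-- `A` is a coset of the subgroup `D`. -/
def IsCosetOf {V : Type*} [AddCommGroup V] (A : Set V) (D : AddSubgroup V) : Prop :=
  A.Nonempty ∧ ∀ v ∈ A, ∀ w, w ∈ A ↔ w - v ∈ D

lemma card_mul_relIndex_of_le {V : Type*} [AddCommGroup V] {H K : AddSubgroup V} (h : H ≤ K) :
    Nat.card H * H.relIndex K = Nat.card K := by
  rw [← AddSubgroup.relIndex_bot_left, ← AddSubgroup.relIndex_bot_left]
  exact AddSubgroup.relIndex_mul_relIndex _ _ _ bot_le h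

section Coset

variable {V : Type*} [AddCommGroup V] {A A' B B' : Set V} {D D' E E' : AddSubgroup V}

lemma IsCosetOf.ncard_eq (h : IsCosetOf A D) : A.ncard = Nat.card D := by
  obtain ⟨⟨a, ha⟩, h⟩ := h
  have hA : A = (fun u => u + a) '' (D : Set V) := by
    ext w
    rw [h a ha w]
    constructor
    · intro hw
      exact ⟨w - a, hw, sub_add_cancel w a⟩
    · rintro ⟨u, hu, rfl⟩
      simpa using hu
  rw [hA, Set.ncard_image_of_injective _ (add_left_injective a)]
  rfl

lemma IsCosetOf.inter (h : IsCosetOf A D) (h' : IsCosetOf A' D') (hne : (A ∩ A').Nonempty) :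
    IsCosetOf (A ∩ A') (D ⊓ D') :=
  ⟨hne, fun v hv w => and_congr (h.2 v hv.1 w) (h'.2 v hv.2 w)⟩

variable [Finite V]

/-- Two distinct cosets of the same size that meet in more than a third of their points
have directions meeting in index two. -/
lemma IsCosetOf.relIndex_eq_two (h : IsCosetOf A D) (h' : IsCosetOf A' D')
    (hcard : A'.ncard = A.ncard) (hne : A ≠ A') (hlt : A.ncard < 3 * (A ∩ A').ncard) :
    D'.relIndex D = 2 ∧ 2 * (A ∩ A').ncard = A.ncard := by
  have hmeet : (A ∩ A').Nonempty := by
    rw [← Set.ncard_pos (Set.toFinite _)]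
    omega
  have hI := h.inter h' hmeet
  have hmul : D'.relIndex D * (A ∩ A').ncard = A.ncard := by
    rw [hI.ncard_eq, h.ncard_eq, ← AddSubgroup.inf_relIndex_left, mul_comm]
    exact card_mul_relIndex_of_le inf_le_left
  have hone : D'.relIndex D ≠ 1 := by
    intro h1
    rw [h1, one_mul] at hmul
    have e1 : A ∩ A' = A := Set.eq_of_subset_of_ncard_le Set.inter_subset_left hmul.ge
    have e2 : A ∩ A' = A' :=
      Set.eq_of_subset_of_ncard_le Set.inter_subset_right (by omega)
    exact hne (e1.symm.trans e2)
  have hzero : D'.relIndex D ≠ 0 := by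
    intro h0
    rw [h0, zero_mul] at hmul
    have := (Set.ncard_pos (Set.toFinite A)).2 h.1
    omega
  have htwo : D'.relIndex D < 3 := by
    by_contra! h3
    have := Nat.mul_le_mul_right (A ∩ A').ncard h3
    omega
  have heq : D'.relIndex D = 2 := by omega
  exact ⟨heq, by rw [← hmul, heq]⟩

/-- If two pairs of cosets of the same size have the same symmetric difference and each pair
meets in at most an eighth of the points, then the first coset occurs in the other pair. -/
lemma IsCosetOf.eq_or_eq_of_symmDiff (hA : IsCosetOf A D) (hB : IsCosetOf B E)
    (hA' : IsCosetOf A' D') (hcAB : B.ncard = A.ncard)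
    (hcA' : A'.ncard = A.ncard) (hAB : (A ∩ B).Nonempty)
    (hsm : 8 * (A ∩ B).ncard ≤ A.ncard) (hsm' : 8 * (A' ∩ B').ncard ≤ A.ncard)
    (hsymm : symmDiff A B = symmDiff A' B') : A' = A ∨ A' = B := by
  by_contra! hne
  have hsub : A' ⊆ (A' ∩ A) ∪ (A' ∩ B) ∪ (A' ∩ B') := by
    intro v hv
    by_cases hvB : v ∈ B'
    · exact Or.inr ⟨hv, hvB⟩
    · have : v ∈ symmDiff A B := hsymm ▸ Or.inl ⟨hv, hvB⟩
      rcases this with h | h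
      · exact Or.inl (Or.inl ⟨hv, h.1⟩)
      · exact Or.inl (Or.inr ⟨hv, h.1⟩)
  have hle := Set.ncard_le_ncard hsub (Set.toFinite _)
  have hu1 := Set.ncard_union_le ((A' ∩ A) ∪ (A' ∩ B)) (A' ∩ B')
  have hu2 := Set.ncard_union_le (A' ∩ A) (A' ∩ B)
  have hpos := (Set.ncard_pos (Set.toFinite A)).2 hA.1
  have bound : ∀ {C : Set V} {G : AddSubgroup V}, IsCosetOf C G → C.ncard = A'.ncard → A' ≠ C →
      2 * (A' ∩ C).ncard ≤ A'.ncard := by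
    intro C G hC hc hn
    by_cases hlt : A'.ncard < 3 * (A' ∩ C).ncard
    · exact (hA'.relIndex_eq_two hC hc hn hlt).2.le
    · omega
  have b1 := bound hA hcA'.symm hne.1
  have b2 := bound hB (by omega) hne.2
  have r1 := (hA'.relIndex_eq_two hA hcA'.symm hne.1 (by omega)).1
  have r2 := (hA'.relIndex_eq_two hB (by omega) hne.2 (by omega)).1
  have r3 : (D ⊓ E).relIndex D' ≤ 4 := by
    have := AddSubgroup.relIndex_inf_le (H := D) (K := E) (L := D')
    rwa [r1, r2] at this
  have hcard : Nat.card (D ⊓ E ⊓ D' : AddSubgroup V) * (D ⊓ E).relIndex D' = A'.ncard := by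
    rw [hA'.ncard_eq, ← AddSubgroup.inf_relIndex_right]
    exact card_mul_relIndex_of_le inf_le_right
  have hmono : Nat.card (D ⊓ E ⊓ D' : AddSubgroup V) ≤ (A ∩ B).ncard := by
    rw [(hA.inter hB hAB).ncard_eq]
    exact AddSubgroup.card_le_of_le inf_le_left
  have := Nat.mul_le_mul hmono r3
  omega

/-- The unordered pair of cosets is determined by the symmetric difference. -/
lemma IsCosetOf.pair_eq_of_symmDiff (hA : IsCosetOf A D) (hB : IsCosetOf B E)
    (hA' : IsCosetOf A' D') (hcAB : B.ncard = A.ncard)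
    (hcA' : A'.ncard = A.ncard) (hAB : (A ∩ B).Nonempty)
    (hsm : 8 * (A ∩ B).ncard ≤ A.ncard) (hsm' : 8 * (A' ∩ B').ncard ≤ A.ncard)
    (hsymm : symmDiff A B = symmDiff A' B') : (A = A' ∧ B = B') ∨ (A = B' ∧ B = A') := by
  rcases hA.eq_or_eq_of_symmDiff hB hA' hcAB hcA' hAB hsm hsm' hsymm with rfl | rfl
  · exact Or.inl ⟨rfl, symmDiff_right_injective _ hsymm⟩
  · rw [symmDiff_comm] at hsymm
    exact Or.inr ⟨symmDiff_right_injective _ hsymm, rfl⟩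

end Coset

/-! ### Flats cut out by lower triangular systems -/

section Flat

variable {m : ℕ} {B : Fin m → Fin m → ZMod 2} {ε : Fin m → ZMod 2} {S : Finset (Fin m)}

/-- The affine flat on which `act B ε S` equals one. -/
def triFlat (B : Fin m → Fin m → ZMod 2) (ε : Fin m → ZMod 2) (S : Finset (Fin m)) :
    Set (Fin m → ZMod 2) :=
  { v | ∀ i ∈ S, v i + (∑ j, B i j * v j) + ε i = 1 }

/-- The direction of `triFlat B ε S`. -/
def triDir (B : Fin m → Fin m → ZMod 2) (S : Finset (Fin m)) :
    AddSubgroup (Fin m → ZMod 2) where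
  carrier := { v | ∀ i ∈ S, v i + (∑ j, B i j * v j) = 0 }
  zero_mem' := by simp
  add_mem' := by
    intro u v hu hv i hi
    have h1 := hu i hi
    have h2 := hv i hi
    simp only [Pi.add_apply, mul_add, Finset.sum_add_distrib]
    linear_combination h1 + h2
  neg_mem' := by
    intro u hu i hi
    have h1 := hu i hi
    simp only [Pi.neg_apply, mul_neg, Finset.sum_neg_distrib]
    linear_combination -h1

lemma ZMod.prod_two_eq_one_iff {ι : Type*} (s : Finset ι) (f : ι → ZMod 2) :
    ∏ i ∈ s, f i = 1 ↔ ∀ i ∈ s, f i = 1 := by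
  have h2 : ∀ a : ZMod 2, a = 1 ↔ a ≠ 0 := by decide
  simp only [h2, Finset.prod_ne_zero_iff]

lemma act_eq_one_iff (v : Fin m → ZMod 2) : act B ε S v = 1 ↔ v ∈ triFlat B ε S :=
  ZMod.prod_two_eq_one_iff S _

lemma isCosetOf_triFlat (hne : (triFlat B ε S).Nonempty) :
    IsCosetOf (triFlat B ε S) (triDir B S) := by
  refine ⟨hne, fun v hv w => forall₂_congr fun i hi => ?_⟩
  have h1 := hv i hi
  simp only [Pi.sub_apply, mul_sub, Finset.sum_sub_distrib]
  constructor <;> intro h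
  · linear_combination h - h1
  · linear_combination h + h1

lemma triFlat_union (S T : Finset (Fin m)) :
    triFlat B ε (S ∪ T) = triFlat B ε S ∩ triFlat B ε T := by
  ext v
  simp only [triFlat, Finset.mem_union, Set.mem_inter_iff, Set.mem_ofPred_eq]
  grind

/-- The change of coordinates replacing `v i`, for `i ∈ S`, by the corresponding affine form. -/
def triMap (B : Fin m → Fin m → ZMod 2) (ε : Fin m → ZMod 2) (S : Finset (Fin m))
    (v : Fin m → ZMod 2) : Fin m → ZMod 2 :=
  fun i => if i ∈ S then v i + (∑ j, B i j * v j) + ε i else v i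

lemma sum_mul_congr_of_lower (hB : ∀ i j, B i j ≠ 0 → j < i) {i : Fin m}
    {v w : Fin m → ZMod 2} (h : ∀ j < i, v j = w j) :
    ∑ j, B i j * v j = ∑ j, B i j * w j := by
  refine Finset.sum_congr rfl fun j _ => ?_
  by_cases hj : B i j = 0
  · simp [hj]
  · rw [h j (hB i j hj)]

lemma eq_of_triMap_eq (hB : ∀ i j, B i j ≠ 0 → j < i) {v w : Fin m → ZMod 2} (i : Fin m)
    (h : ∀ j ≤ i, triMap B ε S v j = triMap B ε S w j) : v i = w i := by
  induction i using WellFoundedLT.induction with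
  | ind i ih =>
    have hlow : ∀ j < i, v j = w j := fun j hj => ih j hj fun k hk => h k (hk.trans hj.le)
    have hi := h i le_rfl
    simp only [triMap, sum_mul_congr_of_lower hB hlow] at hi
    split_ifs at hi
    · linear_combination hi
    · exact hi

lemma triMap_bijective (hB : ∀ i j, B i j ≠ 0 → j < i) :
    Function.Bijective (triMap B ε S) :=
  Finite.injective_iff_bijective.1 fun _ _ h =>
    funext fun i => eq_of_triMap_eq hB i fun j _ => congrFun h j

lemma mem_triFlat_iff (v : Fin m → ZMod 2) :
    v ∈ triFlat B ε S ↔ ∀ i ∈ S, triMap B ε S v i = 1 :=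
  forall₂_congr fun i hi => by simp [triMap, hi]

lemma ncard_triFlat (hB : ∀ i j, B i j ≠ 0 → j < i) :
    (triFlat B ε S).ncard = 2 ^ (m - S.card) := by
  have himg : triMap B ε S '' triFlat B ε S
      = (Fintype.piFinset fun i => if i ∈ S then {1} else Finset.univ :
          Finset (Fin m → ZMod 2)) := by
    have hpre : triFlat B ε S = triMap B ε S ⁻¹'
        (Fintype.piFinset fun i => if i ∈ S then {1} else Finset.univ :
          Finset (Fin m → ZMod 2)) := by
      ext v
      simp only [mem_triFlat_iff, Set.mem_preimage, Finset.mem_coe, Fintype.mem_piFinset]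
      refine forall_congr' fun i => ?_
      by_cases hi : i ∈ S <;> simp [hi]
    rw [hpre, Set.image_preimage_eq _ (triMap_bijective hB).2]
  rw [← Set.ncard_image_of_injective _ (triMap_bijective (ε := ε) (S := S) hB).1, himg,
    Set.ncard_coe_finset, Fintype.card_piFinset]
  have : ∀ i, (if i ∈ S then ({1} : Finset (ZMod 2)) else Finset.univ).card
      = if i ∈ S then 1 else 2 := by
    intro i
    split_ifs <;> simp
  have hcompl : Finset.univ.filter (· ∉ S) = Sᶜ := by
    ext i
    simp
  simp only [this, Finset.prod_ite, Finset.prod_const, one_pow, one_mul, hcompl,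
    Finset.card_compl, Fintype.card_fin]

lemma triFlat_nonempty (hB : ∀ i j, B i j ≠ 0 → j < i) : (triFlat B ε S).Nonempty := by
  rw [← Set.ncard_pos (Set.toFinite _), ncard_triFlat hB]
  positivity

/-- The pivots of a lower triangular system are determined by its flat. -/
lemma mem_pivots_iff (hB : ∀ i j, B i j ≠ 0 → j < i) (i : Fin m) :
    i ∈ S ↔ ∀ v ∈ triFlat B ε S, ∀ w ∈ triFlat B ε S, (∀ j < i, v j = w j) → v i = w i := by
  constructor
  · intro hi v hv w hw h
    have h1 := hv i hi
    rw [sum_mul_congr_of_lower hB h] at h1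
    linear_combination h1 - hw i hi
  · intro h
    by_contra hi
    obtain ⟨v, hv⟩ := (triMap_bijective (ε := ε) (S := S) hB).2 1
    obtain ⟨w, hw⟩ := (triMap_bijective (ε := ε) (S := S) hB).2 (Function.update 1 i 0)
    have hvi : v i = 1 := by simpa [triMap, hi] using congrFun hv i
    have hwi : w i = 0 := by simpa [triMap, hi] using congrFun hw i
    have := h v ((mem_triFlat_iff v).2 fun j _ => by simp [hv])
      w ((mem_triFlat_iff w).2 fun j hj => by
        rw [hw, Function.update_of_ne (ne_of_mem_of_not_mem hj hi), Pi.one_apply])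
      fun j hj => eq_of_triMap_eq hB j fun k hk => by
        rw [hv, hw, Function.update_of_ne (hk.trans_lt hj).ne]
    simp [hvi, hwi] at this

lemma pivots_eq_of_triFlat_eq {B' : Fin m → Fin m → ZMod 2} {ε' : Fin m → ZMod 2}
    {S' : Finset (Fin m)} (hB : ∀ i j, B i j ≠ 0 → j < i) (hB' : ∀ i j, B' i j ≠ 0 → j < i)
    (h : triFlat B ε S = triFlat B' ε' S') : S = S' := by
  ext i
  rw [mem_pivots_iff (ε := ε) hB, h, ← mem_pivots_iff hB']

end Flat

lemma act_congr {m : ℕ} {B B' : Fin m → Fin m → ZMod 2} {ε ε' : Fin m → ZMod 2}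
    {T : Finset (Fin m)} (hB : ∀ i ∈ T, B i = B' i) (hε : ∀ i ∈ T, ε i = ε' i) :
    act B ε T = act B' ε' T := by
  funext v
  exact Finset.prod_congr rfl fun i hi => by rw [hB i hi, hε i hi]

lemma act_mul_act_sdiff {m : ℕ} {B : Fin m → Fin m → ZMod 2} {ε : Fin m → ZMod 2}
    {S T : Finset (Fin m)} (h : T ⊆ S) : act B ε T * act B ε (S \ T) = act B ε S := by
  funext v
  exact (mul_comm _ _).trans (Finset.prod_sdiff h)

/-- The three affine transformations can be merged into a single lower triangular one. -/
lemma exists_act_add_act {m : ℕ} {Sf Sg : Finset (Fin m)} {F : BF m}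
    (hF : F ∈ orbitSub (Sf ∩ Sg) (Sf ∩ Sg) *
      (orbitSub Sf (Sf \ (Sf ∩ Sg)) + orbitSub Sg (Sg \ (Sf ∩ Sg)))) :
    ∃ B ε, (∀ i j, B i j ≠ 0 → j < i) ∧ F = act B ε Sf + act B ε Sg := by
  obtain ⟨_, ⟨h, hh, rfl⟩, _, ⟨_, ⟨f, hf, rfl⟩, _, ⟨g, hg, rfl⟩, rfl⟩, rfl⟩ := hF
  let p : Fin m → (Fin m → Fin m → ZMod 2) × (Fin m → ZMod 2) :=
    fun i => if i ∈ Sf ∩ Sg then h else if i ∈ Sf then f else g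
  refine ⟨fun i => (p i).1 i, fun i => (p i).2 i, ?_, ?_⟩
  · intro i j hij
    dsimp only [p] at hij
    split_ifs at hij
    · exact (hh.2 i j hij).2.1
    · exact (hf.2 i j hij).2.1
    · exact (hg.2 i j hij).2.1
  · have ph : ∀ i ∈ Sf ∩ Sg, p i = h := fun i hi => if_pos hi
    have pf : ∀ i ∈ Sf \ (Sf ∩ Sg), p i = f := fun i hi => by
      rw [Finset.mem_sdiff] at hi
      simp only [p, if_neg hi.2, if_pos hi.1]
    have pg : ∀ i ∈ Sg \ (Sf ∩ Sg), p i = g := fun i hi => by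
      rw [Finset.mem_sdiff] at hi
      have : i ∉ Sf := fun h => hi.2 (Finset.mem_inter.2 ⟨h, hi.1⟩)
      simp only [p, if_neg hi.2, if_neg this]
    have merge : ∀ {T : Finset (Fin m)} {q : (Fin m → Fin m → ZMod 2) × (Fin m → ZMod 2)},
        (∀ i ∈ T, p i = q) →
        act q.1 q.2 T = act (fun i => (p i).1 i) (fun i => (p i).2 i) T := fun hq =>
      act_congr (fun i hi => by rw [hq i hi]) fun i hi => by rw [hq i hi]
    dsimp only
    rw [mul_add, merge ph, merge pf, merge pg, act_mul_act_sdiff Finset.inter_subset_left,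
      act_mul_act_sdiff Finset.inter_subset_right]

lemma symmDiff_triFlat_eq {m : ℕ} {B B' : Fin m → Fin m → ZMod 2} {ε ε' : Fin m → ZMod 2}
    {S T S' T' : Finset (Fin m)}
    (h : act B ε S + act B ε T = act B' ε' S' + act B' ε' T') :
    symmDiff (triFlat B ε S) (triFlat B ε T) = symmDiff (triFlat B' ε' S') (triFlat B' ε' T') := by
  have key : ∀ a b c d : ZMod 2, a + b = c + d →
      ((a = 1 ∧ ¬ b = 1 ∨ b = 1 ∧ ¬ a = 1) ↔ (c = 1 ∧ ¬ d = 1 ∨ d = 1 ∧ ¬ c = 1)) := by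
    decide
  ext v
  simp only [Set.mem_symmDiff, ← act_eq_one_iff]
  exact key _ _ _ _ (congrFun h v)

lemma eight_mul_ncard_inter_triFlat_le {m r μ : ℕ} {B : Fin m → Fin m → ZMod 2}
    {ε : Fin m → ZMod 2} {S T : Finset (Fin m)} (hB : ∀ i j, B i j ≠ 0 → j < i) (hμ3 : 3 ≤ μ)
    (hμr : μ ≤ r) (hrm : μ ≤ m - r) (hS : S.card = r) (hT : T.card = r)
    (hST : (S ∩ T).card = r - μ) :
    8 * (triFlat B ε S ∩ triFlat B ε T).ncard ≤ 2 ^ (m - r) := by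
  have hU := Finset.card_union_add_card_inter S T
  rw [← triFlat_union, ncard_triFlat hB]
  calc 8 * 2 ^ (m - (S ∪ T).card) = 2 ^ (3 + (m - (S ∪ T).card)) := by rw [pow_add]; norm_num
    _ ≤ 2 ^ (m - r) := Nat.pow_le_pow_right two_pos (by omega)

/-- orbits of sub-case A.1 associated with distinct unordered
pairs `{S_f, S_g} ≠ {S_{f'}, S_{g'}}` are disjoint. -/
theorem stmt16 (m r μ : ℕ) (I : Finset (Finset (Fin m))) (hI : Decreasing I)
    (hmax : ∀ T ∈ I, T.card ≤ r) (hex : ∃ T ∈ I, T.card = r)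
    (hμ3 : 3 ≤ μ) (hμr : μ ≤ r) (hrm : μ ≤ m - r)
    (Sf Sg Sf' Sg' : Finset (Fin m))
    (hf : Sf ∈ I) (hfc : Sf.card = r) (hg : Sg ∈ I) (hgc : Sg.card = r)
    (hf' : Sf' ∈ I) (hfc' : Sf'.card = r) (hg' : Sg' ∈ I) (hgc' : Sg'.card = r)
    (hh : (Sf ∩ Sg).card = r - μ) (hh' : (Sf' ∩ Sg').card = r - μ)
    (hpairs : ¬((Sf = Sf' ∧ Sg = Sg') ∨ (Sf = Sg' ∧ Sg = Sf'))) :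
    Disjoint
      (orbitSub (Sf ∩ Sg) (Sf ∩ Sg) *
        (orbitSub Sf (Sf \ (Sf ∩ Sg)) + orbitSub Sg (Sg \ (Sf ∩ Sg))))
      (orbitSub (Sf' ∩ Sg') (Sf' ∩ Sg') *
        (orbitSub Sf' (Sf' \ (Sf' ∩ Sg')) +
          orbitSub Sg' (Sg' \ (Sf' ∩ Sg')))) := by
  rw [Set.disjoint_left]
  intro F hF hF'
  obtain ⟨B, ε, hB, rfl⟩ := exists_act_add_act hF
  obtain ⟨B', ε', hB', heq⟩ := exists_act_add_act hF'
  have hne : (triFlat B ε Sf ∩ triFlat B ε Sg).Nonempty := by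
    rw [← triFlat_union]
    exact triFlat_nonempty hB
  have hcf : (triFlat B ε Sf).ncard = 2 ^ (m - r) := by rw [ncard_triFlat hB, hfc]
  have hcg : (triFlat B ε Sg).ncard = 2 ^ (m - r) := by rw [ncard_triFlat hB, hgc]
  have hcf' : (triFlat B' ε' Sf').ncard = 2 ^ (m - r) := by rw [ncard_triFlat hB', hfc']
  have hsm := eight_mul_ncard_inter_triFlat_le (ε := ε) hB hμ3 hμr hrm hfc hgc hh
  have hsm' := eight_mul_ncard_inter_triFlat_le (ε := ε') hB' hμ3 hμr hrm hfc' hgc' hh'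
  refine hpairs ?_
  refine ((isCosetOf_triFlat (triFlat_nonempty hB)).pair_eq_of_symmDiff
    (isCosetOf_triFlat (triFlat_nonempty hB)) (isCosetOf_triFlat (triFlat_nonempty hB'))
    (hcg.trans hcf.symm) (hcf'.trans hcf.symm) hne (hcf ▸ hsm) (hcf ▸ hsm')
    (symmDiff_triFlat_eq heq)).imp ?_ ?_ <;>
  exact And.imp (pivots_eq_of_triFlat_eq hB hB') (pivots_eq_of_triFlat_eq hB hB')
end

section
/- Let I be a decreasing family of finsets of Fin m with r = max_{T ∈ I} |T|, and let μ satisfy m − r ≥ μ and r ≥ μ ≥ 3; set w_μ = 2^{m+1−r} − 2^{m+1−r−μ}. Let S_f ≠ S_{f′} be finsets of Fin m with |S_f| = |S_{f′}| = r and S_f ∉ I, S_{f′} ∉ I, and let S_h, S_{h′} ∈ I_{r−μ} with S_h ⊆ S_f and S_{h′} ⊆ S_{f′}. Then no Boolean function F with w(F) = w_μ belongs to both LTA(m,2)_{S_h}·x^{S_h} · (LTA(m,2)_{S_f}·x^{S_f\S_h} + LTA(m,2)_{S_f}·x^{S_f\S_h}) and LTA(m,2)_{S_{h′}}·x^{S_{h′}}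 · (LTA(m,2)_{S_{f′}}·x^{S_{f′}\S_{h′}} + LTA(m,2)_{S_{f′}}·x^{S_{f′}\S_{h′}}). -/
open Pointwise

section Flats

variable {V : Type*} [AddCommGroup V]

/-- A finite set closed under affine combinations over `ZMod 2`. -/
def IsFlat (A : Finset V) : Prop := ∀ x ∈ A, ∀ y ∈ A, ∀ z ∈ A, x + y + z ∈ A

lemma IsFlat.inter [DecidableEq V] {A B : Finset V} (hA : IsFlat A) (hB : IsFlat B) :
    IsFlat (A ∩ B) := by
  intro x hx y hy z hz
  simp only [Finset.mem_inter] at *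
  exact ⟨hA x hx.1 y hy.1 z hz.1, hB x hx.2 y hy.2 z hz.2⟩

variable [Module (ZMod 2) V]

lemma add_add_self_right (x t : V) : x + t + t = x := by
  rw [add_assoc, ZModModule.add_self, add_zero]

lemma add_pair_add_pair (x a u : V) : x + a + u + a + u = x := by
  rw [show x + a + u + a + u = x + (a + u) + (a + u) by abel, add_add_self_right]

lemma IsFlat.add_notMem {A : Finset V} (hA : IsFlat A) {a u x : V} (ha : a ∈ A) (hu : u ∉ A)
    (hx : x ∈ A) : x + a + u ∉ A := fun h => hu <| by
  have := hA _ h _ hx _ ha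
  rwa [show x + a + u + x + a = u + (x + a) + (x + a) by abel, add_add_self_right] at this

variable [DecidableEq V]

lemma IsFlat.card_le_card_sdiff {A W : Finset V} (hA : IsFlat A) (hW : IsFlat W) (hAW : A ⊆ W)
    (hne : A ≠ W) : A.card ≤ (W \ A).card := by
  rcases A.eq_empty_or_nonempty with rfl | ⟨a, ha⟩
  · simp
  obtain ⟨u, huW, hu⟩ := Finset.exists_of_ssubset (hAW.ssubset_of_ne hne)
  refine Finset.card_le_card_of_injOn (fun x => x + a + u) (fun x hx => ?_) (fun x _ y _ h => ?_)
  · exact Finset.mem_coe.2 <| Finset.mem_sdiff.2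
      ⟨hW _ (hAW hx) _ (hAW ha) _ huW, hA.add_notMem ha hu hx⟩
  · simpa using h

lemma IsFlat.two_mul_card_le {A W : Finset V} (hA : IsFlat A) (hW : IsFlat W) (hAW : A ⊆ W)
    (hne : A ≠ W) : 2 * A.card ≤ W.card := by
  have := hA.card_le_card_sdiff hW hAW hne
  have := Finset.card_sdiff_add_card_eq_card hAW
  omega

/-- The flat generated by `A` and one further direction `t`. -/
lemma IsFlat.union_translate {A : Finset V} (hA : IsFlat A) (t : V) :
    IsFlat (A ∪ A.image (· + t)) := by
  have key : ∀ x, x ∈ A ∪ A.image (· + t) ↔ x ∈ A ∨ x + t ∈ A := by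
    intro x
    simp only [Finset.mem_union, Finset.mem_image]
    refine or_congr_right ⟨?_, fun h => ⟨_, h, add_add_self_right x t⟩⟩
    rintro ⟨y, hy, rfl⟩
    rwa [add_add_self_right]
  have pair : ∀ s : V, s + (t + t) = s := fun s => by rw [ZModModule.add_self, add_zero]
  intro x hx y hy z hz
  rw [key] at *
  rcases hx with hx | hx <;> rcases hy with hy | hy <;> rcases hz with hz | hz <;>
    have h := hA _ hx _ hy _ hz
  · exact .inl h
  · exact .inr (by convert h using 1; abel)
  · exact .inr (by convert h using 1; abel)
  · exact .inl (by rw [← pair (x + y + z)]; convert h using 1; abel)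
  · exact .inr (by convert h using 1; abel)
  · exact .inl (by rw [← pair (x + y + z)]; convert h using 1; abel)
  · exact .inl (by rw [← pair (x + y + z)]; convert h using 1; abel)
  · exact .inr (by rw [← pair (x + y + z + t)]; convert h using 1; abel)

lemma IsFlat.four_mul_card_le {A W : Finset V} (hA : IsFlat A) (hW : IsFlat W) (hAW : A ⊆ W)
    (hlt : 2 * A.card < W.card) : 4 * A.card ≤ W.card := by
  rcases A.eq_empty_or_nonempty with rfl | ⟨a, ha⟩
  · simp
  have hne : A ≠ W := by
    rintro rfl
    omega
  obtain ⟨u, huW, hu⟩ := Finset.exists_of_ssubset (hAW.ssubset_of_ne hne)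
  have hcard : (A ∪ A.image (· + (a + u))).card = 2 * A.card := by
    rw [Finset.card_union_of_disjoint, Finset.card_image_of_injective _ (add_left_injective _),
      two_mul]
    rw [Finset.disjoint_right]
    intro x hx hxA
    obtain ⟨y, hy, rfl⟩ := Finset.mem_image.1 hx
    exact hA.add_notMem ha hu hy (by rwa [add_assoc])
  have hsub : A ∪ A.image (· + (a + u)) ⊆ W := by
    refine Finset.union_subset hAW fun x hx => ?_
    obtain ⟨y, hy, rfl⟩ := Finset.mem_image.1 hx
    rw [← add_assoc]
    exact hW _ (hAW hy) _ (hAW ha) _ huW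
  have := (hA.union_translate (a + u)).two_mul_card_le hW hsub (by rintro h; rw [h] at hcard; omega)
  omega

/-- Two points outside a flat of index two differ by a direction of the flat. -/
lemma IsFlat.add_mem_of_two_mul_card_eq {B W : Finset V} (hB : IsFlat B) (hW : IsFlat W)
    (hBW : B ⊆ W) (hcard : 2 * B.card = W.card) {x a c : V} (hx : x ∈ W \ B) (ha : a ∈ W \ B)
    (hc : c ∈ B) : x + a + c ∈ B := by
  rw [Finset.mem_sdiff] at ha
  have himage : B.image (· + (c + a)) = W \ B := by
    refine Finset.eq_of_subset_of_card_le (fun y hy => ?_) ?_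
    · obtain ⟨b, hb, rfl⟩ := Finset.mem_image.1 hy
      rw [← add_assoc]
      exact Finset.mem_sdiff.2 ⟨hW _ (hBW hb) _ (hBW hc) _ ha.1, hB.add_notMem hc ha.2 hb⟩
    · have := Finset.card_sdiff_add_card_eq_card hBW
      rw [Finset.card_image_of_injective _ (add_left_injective _)]
      omega
  rw [← himage] at hx
  obtain ⟨b, hb, rfl⟩ := Finset.mem_image.1 hx
  rwa [show b + (c + a) + a + c = b + c + a + c + a by abel, add_pair_add_pair]

/-- The symmetric difference of two proper subflats of a flat `W` cannot have size strictly
between three quarters of `W` and all of `W`. -/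
lemma IsFlat.card_symmDiff_not_between {A B W : Finset V} (hA : IsFlat A) (hB : IsFlat B)
    (hW : IsFlat W) (hAW : A ⊆ W) (hBW : B ⊆ W) (hAne : A ≠ W) (hBne : B ≠ W)
    (hlo : 3 * W.card < 4 * (symmDiff A B).card) : W.card ≤ (symmDiff A B).card := by
  have hsd : (symmDiff A B).card = (A \ B).card + (B \ A).card :=
    Finset.card_union_of_disjoint disjoint_sdiff_sdiff
  have h1 := Finset.card_sdiff_add_card_inter A B
  have h2 := Finset.card_sdiff_add_card_inter B A
  rw [Finset.inter_comm B A] at h2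
  have hA2 := hA.two_mul_card_le hW hAW hAne
  have hB2 := hB.two_mul_card_le hW hBW hBne
  have hA' : 2 * A.card = W.card := by
    by_contra h
    have := hA.four_mul_card_le hW hAW (by omega)
    omega
  have hB' : 2 * B.card = W.card := by
    by_contra h
    have := hB.four_mul_card_le hW hBW (by omega)
    omega
  rcases (A ∩ B).eq_empty_or_nonempty with h0 | ⟨c, hc⟩
  · rw [h0, Finset.card_empty] at h1 h2
    omega
  rw [Finset.mem_inter] at hc
  have hle : (A \ B).card ≤ (A ∩ B).card := by
    rcases (A \ B).eq_empty_or_nonempty with h0 | ⟨a, ha⟩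
    · simp [h0]
    have hmono := Finset.sdiff_subset_sdiff hAW (le_refl B)
    refine Finset.card_le_card_of_injOn (fun x => x + a + c) (fun x hx => ?_)
      (fun x _ y _ h => by simpa using h)
    have hx' := Finset.mem_sdiff.1 (Finset.mem_coe.1 hx)
    exact Finset.mem_coe.2 <| Finset.mem_inter.2
      ⟨hA _ hx'.1 _ (Finset.mem_sdiff.1 ha).1 _ hc.1,
        hB.add_mem_of_two_mul_card_eq hW hBW hB' (hmono hx) (hmono ha) hc.2⟩
  omega

/-- A large but not full symmetric difference of equal-sized flats determines its components. -/
lemma IsFlat.eq_or_eq_of_symmDiff_eq {A B C D : Finset V} (hA : IsFlat A) (hB : IsFlat B)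
    (hC : IsFlat C) (hAC : A.card = C.card) (hBC : B.card = C.card) (hDC : D.card = C.card)
    (h : symmDiff A B = symmDiff C D) (hlo : 3 * C.card < 2 * (symmDiff C D).card)
    (hhi : (symmDiff C D).card < 2 * C.card) : C = A ∨ C = B := by
  have hsd : (symmDiff C D).card = (C \ D).card + (D \ C).card :=
    Finset.card_union_of_disjoint disjoint_sdiff_sdiff
  have h1 := Finset.card_sdiff_add_card_inter C D
  have h2 := Finset.card_sdiff_add_card_inter D C
  rw [Finset.inter_comm D C] at h2
  have hrest : symmDiff (C ∩ A) (C ∩ B) = C \ D := by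
    ext v
    have := Finset.ext_iff.1 h v
    simp only [Finset.mem_symmDiff, Finset.mem_inter, Finset.mem_sdiff] at this ⊢
    tauto
  by_contra! hne
  have hnotsub : ∀ E : Finset V, E.card = C.card → C ≠ E → C ∩ E ≠ C := fun E hE hCE hI =>
    hCE (Finset.eq_of_subset_of_card_le (Finset.inter_eq_left.1 hI) hE.le)
  have := (hC.inter hA).card_symmDiff_not_between (hC.inter hB) hC Finset.inter_subset_left
    Finset.inter_subset_left (hnotsub A hAC hne.1) (hnotsub B hBC hne.2)
    (by rw [hrest]; omega)
  rw [hrest] at this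
  omega

end Flats

section Triangular

variable {m : ℕ}

/-- The affine map `v ↦ v + B v + ε`. -/
def affMap (B : Fin m → Fin m → ZMod 2) (ε : Fin m → ZMod 2) (v : Fin m → ZMod 2) :
    Fin m → ZMod 2 := fun i => v i + (∑ j, B i j * v j) + ε i

/-- The points where `act B ε S` equals one. -/
def actSupport (B : Fin m → Fin m → ZMod 2) (ε : Fin m → ZMod 2) (S : Finset (Fin m)) :
    Finset (Fin m → ZMod 2) := Finset.univ.filter fun v => ∀ i ∈ S, affMap B ε v i = 1

lemma zmod_two_prod_eq_one_iff {ι : Type*} (S : Finset ι) (f : ι → ZMod 2) :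
    ∏ i ∈ S, f i = 1 ↔ ∀ i ∈ S, f i = 1 := by
  have h : ∀ a : ZMod 2, a = 1 ↔ a ≠ 0 := by decide
  simp only [h, Finset.prod_ne_zero_iff]

lemma mem_actSupport {B : Fin m → Fin m → ZMod 2} {ε : Fin m → ZMod 2} {S : Finset (Fin m)}
    {v : Fin m → ZMod 2} : v ∈ actSupport B ε S ↔ act B ε S v = 1 := by
  rw [actSupport, Finset.mem_filter, act, zmod_two_prod_eq_one_iff]
  simp only [Finset.mem_univ, true_and, affMap]

lemma isFlat_actSupport (B : Fin m → Fin m → ZMod 2) (ε : Fin m → ZMod 2)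
    (S : Finset (Fin m)) : IsFlat (actSupport B ε S) := by
  intro x hx y hy z hz
  simp only [actSupport, Finset.mem_filter, Finset.mem_univ, true_and] at *
  intro i hi
  have h : affMap B ε (x + y + z) i = affMap B ε x i + affMap B ε y i + affMap B ε z i := by
    simp only [affMap, Pi.add_apply, mul_add, Finset.sum_add_distrib]
    linear_combination - CharTwo.add_self_eq_zero (ε i)
  rw [h, hx i hi, hy i hi, hz i hi]
  decide

variable {B : Fin m → Fin m → ZMod 2} {ε : Fin m → ZMod 2}

lemma affMap_sub_apply (hB : ∀ i j, B i j ≠ 0 → j < i) {v w : Fin m → ZMod 2} {i : Fin m}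
    (h : ∀ j < i, v j = w j) : affMap B ε v i - affMap B ε w i = v i - w i := by
  have hsum : ∑ j, B i j * v j = ∑ j, B i j * w j := by
    refine Finset.sum_congr rfl fun j _ => ?_
    by_cases hij : B i j = 0
    · simp [hij]
    · rw [h j (hB i j hij)]
  simp only [affMap, hsum]
  ring

lemma apply_eq_of_affMap_eq (hB : ∀ i j, B i j ≠ 0 → j < i) {v w : Fin m → ZMod 2} (i : Fin m)
    (h : ∀ j ≤ i, affMap B ε v j = affMap B ε w j) : v i = w i := by
  induction i using WellFoundedLT.induction with
  | ind i ih =>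
    have hlt : ∀ j < i, v j = w j := fun j hj => ih j hj fun k hk => h k (hk.trans hj.le)
    rw [← sub_eq_zero, ← affMap_sub_apply (ε := ε) hB hlt, h i le_rfl, sub_self]

lemma affMap_bijective (hB : ∀ i j, B i j ≠ 0 → j < i) : Function.Bijective (affMap B ε) :=
  Finite.injective_iff_bijective.1 fun _ _ h =>
    funext fun i => apply_eq_of_affMap_eq hB i fun j _ => congrFun h j

lemma card_actSupport (hB : ∀ i j, B i j ≠ 0 → j < i) (S : Finset (Fin m)) :
    (actSupport B ε S).card = 2 ^ (m - S.card) := by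
  have h : (actSupport B ε S).map ⟨affMap B ε, (affMap_bijective hB).1⟩ =
      Fintype.piFinset fun i => if i ∈ S then {1} else Finset.univ := by
    ext w
    obtain ⟨v, rfl⟩ := (affMap_bijective (ε := ε) hB).2 w
    simp only [Finset.mem_map, Function.Embedding.coeFn_mk, Fintype.mem_piFinset, actSupport,
      Finset.mem_filter, Finset.mem_univ, true_and]
    constructor
    · rintro ⟨u, hu, huv⟩ i
      rw [← huv]
      split_ifs with hi <;> simp [hu, hi]
    · refine fun hv => ⟨v, fun i hi => ?_, rfl⟩
      simpa [hi] using hv i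
  rw [← Finset.card_map, h, Fintype.card_piFinset]
  simp only [apply_ite Finset.card, Finset.card_singleton, Finset.card_univ, ZMod.card]
  rw [Finset.prod_ite]
  have hcompl : (Finset.univ.filter fun i => i ∉ S) = Sᶜ := by
    ext
    simp
  simp [hcompl, Finset.card_compl]

/-- The index set `S` is recovered from the support: `i ∉ S` exactly when two points of the support
agree before `i` and differ at `i`. -/
lemma notMem_iff_exists_actSupport (hB : ∀ i j, B i j ≠ 0 → j < i) (S : Finset (Fin m))
    (i : Fin m) : i ∉ S ↔ ∃ v ∈ actSupport B ε S, ∃ w ∈ actSupport B ε S,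
      (∀ j < i, v j = w j) ∧ v i ≠ w i := by
  constructor
  · intro hi
    obtain ⟨v, hv⟩ := (affMap_bijective (ε := ε) hB).2 1
    obtain ⟨w, hw⟩ := (affMap_bijective (ε := ε) hB).2 (Function.update 1 i 0)
    have hlt : ∀ j < i, v j = w j := fun j hj => by
      refine apply_eq_of_affMap_eq (ε := ε) hB j fun k hk => ?_
      rw [hv, hw, Function.update_of_ne (hk.trans_lt hj).ne]
    refine ⟨v, ?_, w, ?_, hlt, fun h => ?_⟩
    · simp [actSupport, hv]
    · simp only [actSupport, Finset.mem_filter, Finset.mem_univ, true_and, hw]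
      intro k hk
      rw [Function.update_of_ne (ne_of_mem_of_not_mem hk hi), Pi.one_apply]
    · have := affMap_sub_apply (ε := ε) hB hlt
      rw [h, hv, hw, sub_self, Function.update_self, Pi.one_apply, sub_zero] at this
      exact one_ne_zero this
  · rintro ⟨v, hv, w, hw, hlt, hne⟩ hi
    simp only [actSupport, Finset.mem_filter, Finset.mem_univ, true_and] at hv hw
    refine hne ?_
    rw [← sub_eq_zero, ← affMap_sub_apply (ε := ε) hB hlt, hv i hi, hw i hi, sub_self]

lemma eq_of_actSupport_eq {B' : Fin m → Fin m → ZMod 2} {ε' : Fin m → ZMod 2}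
    (hB : ∀ i j, B i j ≠ 0 → j < i) (hB' : ∀ i j, B' i j ≠ 0 → j < i) {S S' : Finset (Fin m)}
    (h : actSupport B ε S = actSupport B' ε' S') : S = S' := by
  ext i
  rw [← not_iff_not, notMem_iff_exists_actSupport (ε := ε) hB, h,
    ← notMem_iff_exists_actSupport hB']

/-- A product of orbit elements of `x^T` and `x^(S \ T)` is in the full orbit of `x^S`. -/
lemma mul_mem_orbitFull {S T : Finset (Fin m)} (hTS : T ⊆ S) {P Q : BF m}
    (hP : P ∈ orbitSub T T) (hQ : Q ∈ orbitSub S (S \ T)) : P * Q ∈ orbitFull S := by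
  obtain ⟨p, hp, rfl⟩ := hP
  obtain ⟨q, hq, rfl⟩ := hQ
  refine ⟨fun i => if i ∈ T then p.1 i else q.1 i, fun i => if i ∈ T then p.2 i else q.2 i,
    fun i j hij => ?_, ?_⟩
  · by_cases hi : i ∈ T
    · exact (hp.2 i j (by simpa [hi] using hij)).2.1
    · exact (hq.2 i j (by simpa [hi] using hij)).2.1
  · funext v
    simp only [act, Pi.mul_apply]
    rw [← Finset.prod_sdiff hTS, mul_comm]
    refine congrArg₂ _ (Finset.prod_congr rfl fun i hi => ?_)
      (Finset.prod_congr rfl fun i hi => ?_)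
    · simp [(Finset.mem_sdiff.1 hi).2]
    · simp [hi]

/-- The support of an element of the sub-case orbit is the symmetric difference of two supports. -/
lemma exists_filter_eq_symmDiff {S T : Finset (Fin m)} (hTS : T ⊆ S) {F : BF m}
    (hF : F ∈ orbitSub T T * (orbitSub S (S \ T) + orbitSub S (S \ T))) :
    ∃ (B C : Fin m → Fin m → ZMod 2) (ε δ : Fin m → ZMod 2),
      (∀ i j, B i j ≠ 0 → j < i) ∧ (∀ i j, C i j ≠ 0 → j < i) ∧
      (Finset.univ.filter fun v => F v = 1) =
        symmDiff (actSupport B ε S) (actSupport C δ S) := by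
  obtain ⟨P, hP, _, ⟨Q, hQ, R, hR, rfl⟩, rfl⟩ := hF
  obtain ⟨B, ε, hB, hPQ⟩ := mul_mem_orbitFull hTS hP hQ
  obtain ⟨C, δ, hC, hPR⟩ := mul_mem_orbitFull hTS hP hR
  refine ⟨B, C, ε, δ, hB, hC, ?_⟩
  ext v
  have key : ∀ a b : ZMod 2, a + b = 1 ↔ a = 1 ∧ ¬b = 1 ∨ b = 1 ∧ ¬a = 1 := by decide
  simp only [Finset.mem_filter, Finset.mem_univ, true_and, Finset.mem_symmDiff, mem_actSupport,
    ← hPQ, ← hPR, ← key, Pi.mul_apply, Pi.add_apply, mul_add]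

end Triangular

/-- no weight-`w_μ` Boolean function lies in the sub-case B.1
orbits of two distinct monomials `S_f ≠ S_{f'}` outside `I`. -/
theorem stmt17 (m r μ : ℕ) (I : Finset (Finset (Fin m))) (hI : Decreasing I)
    (hmax : ∀ T ∈ I, T.card ≤ r) (hex : ∃ T ∈ I, T.card = r)
    (hμ3 : 3 ≤ μ) (hμr : μ ≤ r) (hrm : μ ≤ m - r)
    (Sf Sf' : Finset (Fin m)) (hne : Sf ≠ Sf')
    (hfc : Sf.card = r) (hfc' : Sf'.card = r)
    (hfI : Sf ∉ I) (hfI' : Sf' ∉ I)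
    (Sh Sh' : Finset (Fin m))
    (hShI : Sh ∈ I) (hShc : Sh.card = r - μ) (hSh : Sh ⊆ Sf)
    (hShI' : Sh' ∈ I) (hShc' : Sh'.card = r - μ) (hSh' : Sh' ⊆ Sf')
    (F : BF m) (hwt : wt F = 2 ^ (m + 1 - r) - 2 ^ (m + 1 - r - μ)) :
    ¬(F ∈ orbitSub Sh Sh *
        (orbitSub Sf (Sf \ Sh) + orbitSub Sf (Sf \ Sh)) ∧
      F ∈ orbitSub Sh' Sh' *
        (orbitSub Sf' (Sf' \ Sh') + orbitSub Sf' (Sf' \ Sh'))) := by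
  rintro ⟨hF, hF'⟩
  obtain ⟨B, C, ε, δ, hB, hC, hBC⟩ := exists_filter_eq_symmDiff hSh hF
  obtain ⟨B', C', ε', δ', hB', hC', hBC'⟩ := exists_filter_eq_symmDiff hSh' hF'
  have hcard : (symmDiff (actSupport B' ε' Sf') (actSupport C' δ' Sf')).card =
      2 ^ (m + 1 - r) - 2 ^ (m + 1 - r - μ) := by
    rw [← hBC', ← hwt, wt]
  have hN : 2 ^ (m + 1 - r) = 2 * 2 ^ (m - r) := by
    rw [← pow_succ', show m + 1 - r = m - r + 1 by omega]
  have hK : 2 ^ (m + 1 - r - μ) * 4 ≤ 2 ^ (m - r) := by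
    rw [show 4 = 2 ^ 2 by rfl, ← pow_add]
    exact Nat.pow_le_pow_right two_pos (by omega)
  have hK0 : 0 < 2 ^ (m + 1 - r - μ) := by positivity
  have hcB := card_actSupport (ε := ε) hB Sf
  have hcC := card_actSupport (ε := δ) hC Sf
  have hcB' := card_actSupport (ε := ε') hB' Sf'
  have hcC' := card_actSupport (ε := δ') hC' Sf'
  rw [hfc] at hcB hcC
  rw [hfc'] at hcB' hcC'
  rcases (isFlat_actSupport B ε Sf).eq_or_eq_of_symmDiff_eq (isFlat_actSupport C δ Sf)
    (isFlat_actSupport B' ε' Sf') (hcB.trans hcB'.symm) (hcC.trans hcB'.symm)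
    (hcC'.trans hcB'.symm) (hBC.symm.trans hBC') (by omega) (by omega) with h | h
  · exact hne (eq_of_actSupport_eq hB' hB h).symm
  · exact hne (eq_of_actSupport_eq hB' hC h).symm
end
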